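/- Assume in addition that there is C₀ > 0 with y·W′(y) − W(y) ≥ C₀·y² for all y ≥ 0. There exist constants C, c > 0 depending only on d, ν and C₀ such that the following holds. Let h be a classical solution on [0,T] of the homogeneous KPZ equation ∂ₜh = νΔh + λV(∇h) with h₀ ∈ W^{1,∞}(ℝ^d) ∩ L¹(ℝ^d), ∇h₀ ∈ L¹(ℝ^d) and ‖h₀‖₁ > 0. Set J := max( 1, ‖∇h₀‖₁/‖h₀‖₁, λ‖∇h₀‖_∞·(1 + c·λ‖h₀‖_∞) ) · ‖h₀‖₁ · e^{c·λ‖h₀‖_∞}. Then for every t ∈ [0,T], ‖∇h(t,·)‖₁ ≤ C·max(J, J^{1+1/d})·(1+t)^{−1/2}. -/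

import Mathlib

open MeasureTheory Real Set
open scoped ENNReal

noncomputable section

/-- The Laplacian of a function `f : ℝ^d → ℝ` at `x`, as the trace of the second derivative. -/
def lapl {d : ℕ} (f : EuclideanSpace ℝ (Fin d) → ℝ) (x : EuclideanSpace ℝ (Fin d)) : ℝ :=
  ∑ i : Fin d,
    iteratedFDeriv ℝ 2 f x ![EuclideanSpace.single i (1:ℝ), EuclideanSpace.single i (1:ℝ)]

/-- Standing assumptions on the deposition rate `V` (with radial profile `W`):
`V` is `C²`, isotropic, convex, `W 0 = 0`, `W ≥ 0` and `W y ≤ y²` on `[0,∞)`. -/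
structure IsDepositionRate (d : ℕ) (V : EuclideanSpace ℝ (Fin d) → ℝ) (W : ℝ → ℝ) : Prop where
  smooth : ContDiff ℝ 2 V
  isotropic : ∀ p, V p = W ‖p‖
  convex : ConvexOn ℝ Set.univ V
  zero : W 0 = 0
  nonneg : ∀ y : ℝ, 0 ≤ y → 0 ≤ W y
  quadGrowth : ∀ y : ℝ, 0 ≤ y → W y ≤ y ^ 2

/-- `h₀ ∈ W^{1,∞}(ℝ^d)`: differentiable, bounded, with bounded gradient. -/
structure MemW1inf {d : ℕ} (h₀ : EuclideanSpace ℝ (Fin d) → ℝ) : Prop where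
  diff : Differentiable ℝ h₀
  bdd : ∃ C, ∀ x, |h₀ x| ≤ C
  grad_bdd : ∃ C, ∀ x, ‖gradient h₀ x‖ ≤ C

/-- A classical solution on `[0,T]` of the homogeneous KPZ equation
`∂ₜ h = ν Δ h + λ V (∇ h)` with initial condition `h₀`: continuous on `[0,T] × ℝ^d`,
`C¹` in time and `C²` in space on `(0,T] × ℝ^d`, bounded together with its spatial
gradient, and satisfying the equation pointwise on `(0,T] × ℝ^d`. -/
structure IsClassicalSolution {d : ℕ} (ν lam T : ℝ)
    (V : EuclideanSpace ℝ (Fin d) → ℝ)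
    (h₀ : EuclideanSpace ℝ (Fin d) → ℝ)
    (h : ℝ → EuclideanSpace ℝ (Fin d) → ℝ) : Prop where
  cont : ContinuousOn (fun p : ℝ × EuclideanSpace ℝ (Fin d) => h p.1 p.2)
      (Set.Icc 0 T ×ˢ Set.univ)
  space_reg : ∀ t ∈ Set.Ioc (0:ℝ) T, ContDiff ℝ 2 (h t)
  time_reg : ∀ (x : EuclideanSpace ℝ (Fin d)), ∀ t ∈ Set.Ioc (0:ℝ) T,
      DifferentiableAt ℝ (fun s => h s x) t
  bdd : ∃ C, ∀ t ∈ Set.Icc (0:ℝ) T, ∀ x, |h t x| ≤ C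
  grad_bdd : ∃ C, ∀ t ∈ Set.Icc (0:ℝ) T, ∀ x, ‖gradient (h t) x‖ ≤ C
  pde : ∀ t ∈ Set.Ioc (0:ℝ) T, ∀ x, deriv (fun s => h s x) t
      = ν * lapl (h t) x + lam * V (gradient (h t) x)
  init : ∀ x, h 0 x = h₀ x

open Filter Topology

/-- `F` has first derivative `a` and second derivative `b` at `0`. -/
def D2 (F : ℝ → ℝ) (a b : ℝ) : Prop :=
  ∃ F' : ℝ → ℝ, (∀ᶠ s in 𝓝 (0:ℝ), HasDerivAt F (F' s) s) ∧ F' 0 = a ∧ HasDerivAt F' b 0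

lemma D2.hasDerivAt {F : ℝ → ℝ} {a b : ℝ} (h : D2 F a b) : HasDerivAt F a 0 := by
  obtain ⟨F', h1, h2, h3⟩ := h
  have := h1.self_of_nhds
  rwa [h2] at this

lemma D2.add {F G : ℝ → ℝ} {a b a' b' : ℝ} (h : D2 F a b) (h' : D2 G a' b') :
    D2 (fun s => F s + G s) (a + a') (b + b') := by
  obtain ⟨F', h1, h2, h3⟩ := h
  obtain ⟨G', g1, g2, g3⟩ := h'
  refine ⟨fun s => F' s + G' s, ?_, by simp [h2, g2], h3.add g3⟩
  filter_upwards [h1, g1] with s hs gs using hs.add gs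

lemma D2.const_mul {F : ℝ → ℝ} {a b : ℝ} (c : ℝ) (h : D2 F a b) :
    D2 (fun s => c * F s) (c * a) (c * b) := by
  obtain ⟨F', h1, h2, h3⟩ := h
  refine ⟨fun s => c * F' s, ?_, by simp [h2], h3.const_mul c⟩
  filter_upwards [h1] with s hs using hs.const_mul c

lemma D2.sub {F G : ℝ → ℝ} {a b a' b' : ℝ} (h : D2 F a b) (h' : D2 G a' b') :
    D2 (fun s => F s - G s) (a - a') (b - b') := by
  obtain ⟨F', h1, h2, h3⟩ := h
  obtain ⟨G', g1, g2, g3⟩ := h'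
  refine ⟨fun s => F' s - G' s, ?_, by simp [h2, g2], h3.sub g3⟩
  filter_upwards [h1, g1] with s hs gs using hs.sub gs

lemma D2.exp {F : ℝ → ℝ} {a b : ℝ} (h : D2 F a b) :
    D2 (fun s => Real.exp (F s)) (a * Real.exp (F 0)) ((b + a ^ 2) * Real.exp (F 0)) := by
  have h0 := h.hasDerivAt
  obtain ⟨F', h1, h2, h3⟩ := h
  refine ⟨fun s => Real.exp (F s) * F' s, ?_, by simp [h2]; ring, ?_⟩
  · filter_upwards [h1] with s hs using hs.exp
  · have := h0.exp.mul h3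
    rw [h2] at this
    exact this.congr_deriv (by ring)

lemma D2.of_le {F : ℝ → ℝ} {a b : ℝ} (h : D2 F a b) (hm : IsLocalMax F 0) : a = 0 ∧ b ≤ 0 := by
  have ha : a = 0 := hm.hasDerivAt_eq_zero h.hasDerivAt
  refine ⟨ha, ?_⟩
  by_contra! hb
  obtain ⟨F', h1, h2, h3⟩ := h
  have hpos : ∀ᶠ s in 𝓝[>] (0:ℝ), 0 < F' s := by
    have h4 := (hasDerivAt_iff_tendsto_slope_zero.1 h3)
    have h5 : ∀ᶠ s in 𝓝[>] (0:ℝ), 0 < s⁻¹ • (F' (0 + s) - F' 0) :=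
      (h4.mono_left (nhdsWithin_mono _ (fun x hx => ne_of_gt hx))).eventually (lt_mem_nhds hb)
    filter_upwards [h5, self_mem_nhdsWithin] with s hs hs0
    have hs0 : 0 < s := hs0
    rw [h2, ha] at hs
    simp only [zero_add, sub_zero, smul_eq_mul] at hs
    exact (pos_iff_pos_of_mul_pos hs).1 (inv_pos.2 hs0)
  have h1' : ∀ᶠ s in 𝓝[>] (0:ℝ), HasDerivAt F (F' s) s := h1.filter_mono nhdsWithin_le_nhds
  have hm' : ∀ᶠ s in 𝓝[>] (0:ℝ), F s ≤ F 0 := hm.filter_mono nhdsWithin_le_nhds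
  obtain ⟨u, hu0, hu⟩ := (mem_nhdsGT_iff_exists_Ioo_subset).1 (hpos.and (h1'.and hm'))
  have hu0 : 0 < u := hu0
  have hmono : StrictMonoOn F (Icc 0 (u/2)) := by
    apply strictMonoOn_of_deriv_pos (convex_Icc _ _)
    · intro s hs
      rcases eq_or_lt_of_le hs.1 with h | h
      · rw [← h]; exact h1.self_of_nhds.continuousAt.continuousWithinAt
      · exact (hu ⟨h, by linarith [hs.2]⟩).2.1.continuousAt.continuousWithinAt
    · intro s hs
      rw [interior_Icc] at hs
      have := hu ⟨hs.1, by linarith [hs.2]⟩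
      rw [this.2.1.deriv]; exact this.1
  have := hmono ⟨le_rfl, by linarith⟩ ⟨by linarith, le_rfl⟩ (by linarith : (0:ℝ) < u/2)
  have h6 := (hu ⟨by linarith, by linarith⟩ : u/2 ∈ _).2.2
  linarith

lemma deriv_nonneg_of_left_max {φ : ℝ → ℝ} {φ' t a : ℝ} (hφ : HasDerivAt φ φ' t) (ha : a < t)
    (hm : ∀ s ∈ Ico a t, φ s ≤ φ t) : 0 ≤ φ' := by
  have h := (hasDerivWithinAt_iff_tendsto_slope' (by simp)).1 (hφ.hasDerivWithinAt (s := Iio t))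
  refine ge_of_tendsto h ?_
  filter_upwards [Ico_mem_nhdsLT ha] with s hs
  rw [slope_def_field]
  have := hm s hs
  exact div_nonneg_of_nonpos (by linarith) (by linarith [hs.2])

lemma deriv_nonpos_of_right_max {φ : ℝ → ℝ} {φ' : ℝ} (hφ : HasDerivAt φ φ' 0)
    (hm : ∀ᶠ s in 𝓝[>] (0:ℝ), φ s ≤ φ 0) : φ' ≤ 0 := by
  have h := (hasDerivWithinAt_iff_tendsto_slope' (by simp)).1 (hφ.hasDerivWithinAt (s := Ioi 0))
  refine le_of_tendsto h ?_
  filter_upwards [hm, self_mem_nhdsWithin] with s hs hs0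
  have hs0 : 0 < s := hs0
  rw [slope_def_field]
  exact div_nonpos_of_nonpos_of_nonneg (by linarith) (by linarith)

lemma D2_normsq {d : ℕ} (x e : EuclideanSpace ℝ (Fin d)) :
    D2 (fun s : ℝ => ‖x + s • e‖ ^ 2) (2 * inner ℝ x e) (2 * ‖e‖ ^ 2) := by
  have key : (fun s : ℝ => ‖x + s • e‖ ^ 2)
      = fun s => ‖x‖ ^ 2 + 2 * inner ℝ x e * s + ‖e‖ ^ 2 * s ^ 2 := by
    funext s
    rw [norm_add_sq_real, inner_smul_right, norm_smul, mul_pow, Real.norm_eq_abs, sq_abs]; ring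
  rw [key]
  refine ⟨fun s => 2 * inner ℝ x e + 2 * ‖e‖ ^ 2 * s, Eventually.of_forall fun s => ?_, by simp, ?_⟩
  · have h1 := ((hasDerivAt_id s).const_mul (2 * inner ℝ x e)).const_add (‖x‖ ^ 2)
    have h2 := ((hasDerivAt_id s).pow 2).const_mul (‖e‖ ^ 2)
    exact (h1.add h2).congr_deriv (by simp; ring)
  · have h1 := ((hasDerivAt_id (0:ℝ)).const_mul (2 * ‖e‖ ^ 2)).const_add (2 * inner ℝ x e)
    exact h1.congr_deriv (by simp)

lemma D2_contDiff {d : ℕ} {f : EuclideanSpace ℝ (Fin d) → ℝ} (hf : ContDiff ℝ 2 f)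
    (x e : EuclideanSpace ℝ (Fin d)) :
    D2 (fun s : ℝ => f (x + s • e)) (inner ℝ (gradient f x) e)
      (iteratedFDeriv ℝ 2 f x ![e, e]) := by
  have hd : Differentiable ℝ f := hf.differentiable (by norm_num)
  have hd' : Differentiable ℝ (fderiv ℝ f) :=
    (hf.fderiv_right (m := 1) (by norm_num)).differentiable (by norm_num)
  have hline : ∀ s : ℝ, HasDerivAt (fun s : ℝ => x + s • e) e s := by
    intro s
    simpa using ((hasDerivAt_id s).smul_const e).const_add x
  refine ⟨fun s => fderiv ℝ f (x + s • e) e, Eventually.of_forall fun s => ?_, ?_, ?_⟩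
  · exact (hd _).hasFDerivAt.comp_hasDerivAt s (hline s)
  · simp [gradient]
  · have h1 : HasDerivAt (fun s : ℝ => fderiv ℝ f (x + s • e))
        (fderiv ℝ (fderiv ℝ f) (x + (0:ℝ) • e) e) 0 :=
      (hd' _).hasFDerivAt.comp_hasDerivAt 0 (hline 0)
    have h2 := h1.clm_apply (hasDerivAt_const (0:ℝ) e)
    rw [iteratedFDeriv_two_apply]
    exact h2.congr_deriv (by simp)

lemma maxPrinciple {d : ℕ} {ν T : ℝ} (hν : 0 ≤ ν) (f : ℝ → EuclideanSpace ℝ (Fin d) → ℝ)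
    (hc : ContinuousOn (fun p : ℝ × EuclideanSpace ℝ (Fin d) => f p.1 p.2) (Icc 0 T ×ˢ univ))
    (hb : ∃ C, ∀ t ∈ Icc (0:ℝ) T, ∀ x, f t x ≤ C)
    (hpde : ∀ t ∈ Ioc (0:ℝ) T, ∀ x, ∃ ft : ℝ, ∃ a b : Fin d → ℝ,
      HasDerivAt (fun s => f s x) ft t ∧
      (∀ i, D2 (fun s : ℝ => f t (x + s • EuclideanSpace.single i (1:ℝ))) (a i) (b i)) ∧
      ft ≤ ν * ∑ i, b i)
    (B : ℝ) (h0 : ∀ x, f 0 x ≤ B) : ∀ t ∈ Icc (0:ℝ) T, ∀ x, f t x ≤ B := by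
  obtain ⟨C, hC⟩ := hb
  intro t₁ ht₁ x₁
  by_contra! hlt
  set N : ℝ := 2 * d * ν + 1 with hN
  have hNpos : 0 < N := by positivity
  set D : ℝ := ‖x₁‖ ^ 2 + N * t₁ with hD
  have hDnn : 0 ≤ D := by have := ht₁.1; positivity
  set ε : ℝ := (f t₁ x₁ - B) / (2 * (D + 1)) with hε
  have hεpos : 0 < ε := by apply div_pos <;> linarith
  have hεD : ε * (2 * (D + 1)) = f t₁ x₁ - B := by rw [hε]; field_simp
  let g : ℝ → EuclideanSpace ℝ (Fin d) → ℝ := fun t x => f t x - (ε * ‖x‖ ^ 2 + ε * N * t)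
  have hg1 : B < g t₁ x₁ := by
    show B < f t₁ x₁ - (ε * ‖x₁‖ ^ 2 + ε * N * t₁)
    have : ε * ‖x₁‖ ^ 2 + ε * N * t₁ = ε * D := by rw [hD]; ring
    rw [this]; nlinarith
  set R : ℝ := max ‖x₁‖ (max 1 ((C - B) / ε)) with hR
  have hR1 : ‖x₁‖ ≤ R := le_max_left _ _
  have hR2 : 1 ≤ R := (le_max_left _ _).trans (le_max_right _ _)
  have hR3 : (C - B) / ε ≤ R := (le_max_right _ _).trans (le_max_right _ _)
  have hR4 : C - B ≤ ε * R ^ 2 := by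
    rw [div_le_iff₀ hεpos] at hR3
    nlinarith [mul_nonneg hεpos.le (by nlinarith : (0:ℝ) ≤ R * (R - 1))]
  have hK : IsCompact (Icc (0:ℝ) T ×ˢ Metric.closedBall (0 : EuclideanSpace ℝ (Fin d)) R) :=
    isCompact_Icc.prod (isCompact_closedBall _ _)
  have hgc : ContinuousOn (fun p : ℝ × EuclideanSpace ℝ (Fin d) => g p.1 p.2)
      (Icc (0:ℝ) T ×ˢ Metric.closedBall (0 : EuclideanSpace ℝ (Fin d)) R) := by
    refine (hc.mono (prod_mono le_rfl (subset_univ _))).sub ?_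
    fun_prop
  obtain ⟨⟨t, x⟩, ⟨ht, hx⟩, hmax⟩ := hK.exists_isMaxOn
    ⟨(t₁, x₁), ht₁, by simpa using hR1⟩ hgc
  have hgB : B < g t x := hg1.trans_le (hmax (show (t₁, x₁) ∈ _ from ⟨ht₁, by simpa using hR1⟩))
  simp only at ht hx
  have ht0 : 0 < t := by
    rcases eq_or_lt_of_le ht.1 with h | h
    · exfalso
      have h1 := h0 x
      have h2 : g t x ≤ f t x := by
        show f t x - (ε * ‖x‖ ^ 2 + ε * N * t) ≤ f t x
        have := ht.1
        have : 0 ≤ ε * ‖x‖ ^ 2 + ε * N * t := by positivity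
        linarith
      rw [← h] at hgB h2
      linarith
    · exact h
  have hxR : ‖x‖ < R := by
    rcases eq_or_lt_of_le (by simpa using hx : ‖x‖ ≤ R) with h | h
    · exfalso
      have h1 := hC t ht x
      have h2 : g t x = f t x - (ε * ‖x‖ ^ 2 + ε * N * t) := rfl
      rw [h] at h2
      have : 0 ≤ ε * N * t := by have := ht.1; positivity
      linarith
    · exact h
  obtain ⟨ft, a, b, hft, hab, hle⟩ := hpde t ⟨ht0, ht.2⟩ x
  have htime : 0 ≤ ft - ε * N := by
    have hd : HasDerivAt (fun s => g s x) (ft - ε * N) t := by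
      have h1 : HasDerivAt (fun s : ℝ => ε * ‖x‖ ^ 2 + ε * N * s) (ε * N) t := by
        simpa using ((hasDerivAt_id t).const_mul (ε * N)).const_add (ε * ‖x‖ ^ 2)
      exact hft.sub h1
    refine deriv_nonneg_of_left_max hd ht0 fun s hs => ?_
    exact hmax (show (s, x) ∈ _ from ⟨⟨hs.1, hs.2.le.trans ht.2⟩, hx⟩)
  have hspace : ∀ i, b i ≤ 2 * ε := by
    intro i
    have h1 := (hab i).sub ((D2_normsq x (EuclideanSpace.single i (1:ℝ))).const_mul ε)
    have h2 : IsLocalMax (fun s : ℝ => f t (x + s • EuclideanSpace.single i (1:ℝ))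
        - ε * ‖x + s • EuclideanSpace.single i (1:ℝ)‖ ^ 2) 0 := by
      have hcont : Continuous fun s : ℝ => ‖x + s • EuclideanSpace.single i (1:ℝ)‖ := by fun_prop
      have : ∀ᶠ s in 𝓝 (0:ℝ), ‖x + s • EuclideanSpace.single i (1:ℝ)‖ < R :=
        hcont.continuousAt.eventually_lt continuousAt_const (by simpa using hxR)
      filter_upwards [this] with s hs
      have := hmax (show (t, x + s • EuclideanSpace.single i (1:ℝ)) ∈ _ from
        ⟨ht, by simpa using hs.le⟩)
      have h3 : g t (x + s • EuclideanSpace.single i (1:ℝ)) ≤ g t x := this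
      simp only [g] at h3
      simp only [zero_smul, add_zero]
      linarith
    have h3 := (h1.of_le h2).2
    simp at h3
    linarith
  have hsum : ∑ i, b i ≤ d * (2 * ε) := by
    calc ∑ i, b i ≤ ∑ _i : Fin d, 2 * ε := Finset.sum_le_sum fun i _ => hspace i
      _ = d * (2 * ε) := by simp
  have : ν * ∑ i, b i ≤ ν * (d * (2 * ε)) := by gcongr
  have : ε * N = ν * (d * (2 * ε)) + ε := by rw [hN]; ring
  linarith

/-- Gaussian kernel with parameter `τ = 4νt`. -/
def gk {d : ℕ} (τ : ℝ) (x : EuclideanSpace ℝ (Fin d)) : ℝ :=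
  (π * τ) ^ (-(d:ℝ)/2) * Real.exp (-‖x‖ ^ 2 / τ)

/-- Gaussian convolution. -/
def HU {d : ℕ} (g : EuclideanSpace ℝ (Fin d) → ℝ) (τ : ℝ) (x : EuclideanSpace ℝ (Fin d)) : ℝ :=
  ∫ y, gk τ (x - y) * g y

lemma gk_pos {d : ℕ} {τ : ℝ} (hτ : 0 < τ) (x : EuclideanSpace ℝ (Fin d)) : 0 < gk τ x := by
  unfold gk; positivity

lemma gk_continuous {d : ℕ} (τ : ℝ) : Continuous (gk (d := d) τ) := by
  unfold gk; fun_prop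

lemma gk_le {d : ℕ} {τ : ℝ} (hτ : 0 < τ) (x : EuclideanSpace ℝ (Fin d)) :
    gk τ x ≤ (π * τ) ^ (-(d:ℝ)/2) := by
  unfold gk
  refine mul_le_of_le_one_right (by positivity) ?_
  rw [Real.exp_le_one_iff, neg_div]
  have : 0 ≤ ‖x‖ ^ 2 / τ := by positivity
  linarith

lemma gk_normsq_le {d : ℕ} {τ : ℝ} (hτ : 0 < τ) (x : EuclideanSpace ℝ (Fin d)) :
    ‖x‖ ^ 2 * gk τ x ≤ τ * (π * τ) ^ (-(d:ℝ)/2) := by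
  have h := Real.mul_exp_neg_le_exp_neg_one (‖x‖ ^ 2 / τ)
  have h1 : Real.exp (-1) ≤ 1 := by rw [Real.exp_le_one_iff]; norm_num
  have hp : 0 < (π * τ) ^ (-(d:ℝ)/2) := by positivity
  rw [← neg_div] at h
  unfold gk
  calc ‖x‖ ^ 2 * ((π * τ) ^ (-(d:ℝ)/2) * Real.exp (-‖x‖ ^ 2 / τ))
      = τ * (π * τ) ^ (-(d:ℝ)/2) * (‖x‖ ^ 2 / τ * Real.exp (-‖x‖ ^ 2 / τ)) := by
        field_simp
    _ ≤ τ * (π * τ) ^ (-(d:ℝ)/2) * 1 := by gcongr; linarith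
    _ = _ := by ring

lemma exp_integral {d : ℕ} {τ : ℝ} (hτ : 0 < τ) :
    ∫ x : EuclideanSpace ℝ (Fin d), Real.exp (-‖x‖ ^ 2 / τ) = (π * τ) ^ ((d:ℝ)/2) := by
  have h := GaussianFourier.integral_rexp_neg_mul_sq_norm (V := EuclideanSpace ℝ (Fin d))
    (b := 1 / τ) (by positivity)
  simp only [finrank_euclideanSpace, Fintype.card_fin] at h
  rw [show π / (1 / τ) = π * τ by field_simp] at h
  rw [← h]
  congr 1; funext x; congr 1; ring

lemma gk_integral {d : ℕ} {τ : ℝ} (hτ : 0 < τ) :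
    ∫ x : EuclideanSpace ℝ (Fin d), gk τ x = 1 := by
  unfold gk
  rw [integral_const_mul, exp_integral hτ, ← Real.rpow_add (by positivity)]
  rw [show -(d:ℝ)/2 + d/2 = 0 by ring, Real.rpow_zero]

lemma gk_integrable {d : ℕ} {τ : ℝ} (hτ : 0 < τ) :
    Integrable (gk τ : EuclideanSpace ℝ (Fin d) → ℝ) := by
  by_contra h
  have := gk_integral (d := d) hτ
  rw [integral_undef h] at this
  exact zero_ne_one this

lemma hd_int {d : ℕ} {g : EuclideanSpace ℝ (Fin d) → ℝ} (hg : Integrable g)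
    (k k' : ℝ → EuclideanSpace ℝ (Fin d) → ℝ) (s₀ ε C : ℝ) (hε : 0 < ε)
    (hk : ∀ s, Continuous (k s)) (hk' : Continuous (k' s₀)) (hb : ∀ y, |k s₀ y| ≤ C)
    (hb' : ∀ s ∈ Metric.ball s₀ ε, ∀ y, |k' s y| ≤ C)
    (hd : ∀ s ∈ Metric.ball s₀ ε, ∀ y, HasDerivAt (fun s => k s y) (k' s y) s) :
    Integrable (fun y => k' s₀ y * g y) ∧
    HasDerivAt (fun s => ∫ y, k s y * g y) (∫ y, k' s₀ y * g y) s₀ := by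
  refine hasDerivAt_integral_of_dominated_loc_of_deriv_le (s := Metric.ball s₀ ε)
    (bound := fun y => C * |g y|) (F := fun s y => k s y * g y) (F' := fun s y => k' s y * g y)
    (Metric.ball_mem_nhds _ hε)
    (Eventually.of_forall fun s => (hk s).aestronglyMeasurable.mul hg.aestronglyMeasurable)
    ?_ (hk'.aestronglyMeasurable.mul hg.aestronglyMeasurable) ?_ (hg.abs.const_mul C) ?_
  · refine hg.bdd_mul (c := C) (hk s₀).aestronglyMeasurable ?_
    exact Eventually.of_forall hb
  · refine Eventually.of_forall fun y s hs => ?_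
    rw [norm_mul]
    exact mul_le_mul_of_nonneg_right (hb' s hs y) (abs_nonneg _)
  · exact Eventually.of_forall fun y s hs => (hd s hs y).mul_const _

lemma gk_line {d : ℕ} {τ : ℝ} (x : EuclideanSpace ℝ (Fin d)) (i : Fin d) (s : ℝ) :
    HasDerivAt (fun s : ℝ => gk τ (x + s • EuclideanSpace.single i (1:ℝ)))
      (-(2 * (x i + s) / τ) * gk τ (x + s • EuclideanSpace.single i (1:ℝ))) s := by
  have key : ∀ s : ℝ, ‖x + s • EuclideanSpace.single i (1:ℝ)‖ ^ 2
      = ‖x‖ ^ 2 + 2 * x i * s + s ^ 2 := by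
    intro s
    rw [norm_add_sq_real, inner_smul_right, norm_smul, mul_pow, Real.norm_eq_abs, sq_abs]
    simp [EuclideanSpace.inner_single_right]; ring
  have h0 : HasDerivAt (fun s : ℝ => -(‖x‖ ^ 2 + 2 * x i * s + s ^ 2) / τ)
      (-(2 * (x i + s) / τ)) s := by
    have h1 := ((hasDerivAt_id s).const_mul (2 * x i)).const_add (‖x‖ ^ 2)
    have h2 := ((hasDerivAt_id s).pow 2)
    exact (((h1.add h2).neg).div_const τ).congr_deriv (by simp; ring)
  have h3 := (h0.exp).const_mul ((π * τ) ^ (-(d:ℝ)/2))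
  simp only [gk, key]
  exact h3.congr_deriv (by ring)

lemma gk_coord_bound {d : ℕ} {τ : ℝ} (hτ : 0 < τ) (z : EuclideanSpace ℝ (Fin d)) (i : Fin d) :
    |z i| * gk τ z ≤ (1 + τ) * (π * τ) ^ (-(d:ℝ)/2) ∧
    (z i) ^ 2 * gk τ z ≤ τ * (π * τ) ^ (-(d:ℝ)/2) := by
  have h1 : |z i| ≤ ‖z‖ := PiLp.norm_apply_le z i
  have h0 := (gk_pos hτ z).le
  have h2 := gk_le hτ z
  have h3 := gk_normsq_le hτ z
  constructor
  · have h4 : |z i| ≤ 1 + ‖z‖ ^ 2 := by nlinarith [sq_nonneg (‖z‖ - 1), norm_nonneg z]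
    calc |z i| * gk τ z ≤ (1 + ‖z‖ ^ 2) * gk τ z := by gcongr
      _ ≤ _ := by linarith
  · refine le_trans ?_ h3
    have : (z i) ^ 2 ≤ ‖z‖ ^ 2 := by rw [← sq_abs]; gcongr
    gcongr

lemma HU_D2 {d : ℕ} {g : EuclideanSpace ℝ (Fin d) → ℝ} (hg : Integrable g) {τ : ℝ} (hτ : 0 < τ)
    (x : EuclideanSpace ℝ (Fin d)) (i : Fin d) :
    Integrable (fun y => ((4 * (x i - y i) ^ 2 / τ ^ 2 - 2 / τ) * gk τ (x - y)) * g y) ∧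
    D2 (fun s : ℝ => HU g τ (x + s • EuclideanSpace.single i (1:ℝ)))
      (∫ y, (-(2 * (x i - y i) / τ) * gk τ (x - y)) * g y)
      (∫ y, ((4 * (x i - y i) ^ 2 / τ ^ 2 - 2 / τ) * gk τ (x - y)) * g y) := by
  set P : ℝ := (π * τ) ^ (-(d:ℝ)/2) with hP
  have hPpos : 0 < P := by positivity
  set e : EuclideanSpace ℝ (Fin d) := EuclideanSpace.single i (1:ℝ) with he
  have hgc := gk_continuous (d := d) τ
  let k : ℝ → EuclideanSpace ℝ (Fin d) → ℝ := fun s y => gk τ (x - y + s • e)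
  let k1 : ℝ → EuclideanSpace ℝ (Fin d) → ℝ :=
    fun s y => -(2 * ((x - y) i + s) / τ) * gk τ (x - y + s • e)
  let k2 : ℝ → EuclideanSpace ℝ (Fin d) → ℝ :=
    fun s y => (4 * ((x - y) i + s) ^ 2 / τ ^ 2 - 2 / τ) * gk τ (x - y + s • e)
  have hd1 : ∀ s y, HasDerivAt (fun s => k s y) (k1 s y) s := fun s y => gk_line (x - y) i s
  have hd2 : ∀ s y, HasDerivAt (fun s => k1 s y) (k2 s y) s := by
    intro s y
    have h1 : HasDerivAt (fun s : ℝ => -(2 * ((x - y) i + s) / τ)) (-(2 / τ)) s := by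
      have := ((((hasDerivAt_id s).const_add ((x - y) i)).const_mul 2).div_const τ).neg
      exact this.congr_deriv (by simp)
    exact (h1.mul (hd1 s y)).congr_deriv (by simp only [k1, k2, k]; field_simp; ring)
  have hcoord : ∀ s y, (x - y) i + s = (x - y + s • e) i := by
    intro s y; simp [he]
  have hkc : ∀ s, Continuous (k s) := by intro s; simp only [k]; fun_prop
  have hk1c : ∀ s, Continuous (k1 s) := by intro s; simp only [k1]; fun_prop
  have hk2c : ∀ s, Continuous (k2 s) := by intro s; simp only [k2]; fun_prop
  set C : ℝ := P + 2 / τ * ((1 + τ) * P) + (4 / τ ^ 2 * (τ * P) + 2 / τ * P) with hC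
  have n1 : 0 ≤ 2 / τ * ((1 + τ) * P) := by positivity
  have n2 : 0 ≤ 4 / τ ^ 2 * (τ * P) + 2 / τ * P := by positivity
  have hb0 : ∀ s y, |k s y| ≤ C := by
    intro s y
    rw [abs_of_pos (gk_pos hτ _)]
    have := gk_le hτ (x - y + s • e)
    show gk τ _ ≤ C
    linarith
  have hb1 : ∀ s y, |k1 s y| ≤ C := by
    intro s y
    have h1 := (gk_coord_bound hτ (x - y + s • e) i).1
    simp only [k1]
    rw [hcoord, abs_mul, abs_neg, abs_div, abs_mul, abs_two, abs_of_pos hτ,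
      abs_of_pos (gk_pos hτ _)]
    calc 2 * |(x - y + s • e) i| / τ * gk τ (x - y + s • e)
        = 2 / τ * (|(x - y + s • e) i| * gk τ (x - y + s • e)) := by ring
      _ ≤ 2 / τ * ((1 + τ) * P) := by gcongr
      _ ≤ C := by linarith
  have hb2 : ∀ s y, |k2 s y| ≤ C := by
    intro s y
    have h1 := (gk_coord_bound hτ (x - y + s • e) i).2
    have h2 := gk_le hτ (x - y + s • e)
    have h0 := gk_pos hτ (x - y + s • e)
    simp only [k2]
    rw [hcoord, sub_mul]
    refine (abs_sub _ _).trans ?_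
    rw [abs_of_nonneg (by positivity), abs_of_nonneg (by positivity)]
    calc 4 * ((x - y + s • e) i) ^ 2 / τ ^ 2 * gk τ (x - y + s • e) + 2 / τ * gk τ (x - y + s • e)
        = 4 / τ ^ 2 * (((x - y + s • e) i) ^ 2 * gk τ (x - y + s • e))
          + 2 / τ * gk τ (x - y + s • e) := by ring
      _ ≤ 4 / τ ^ 2 * (τ * P) + 2 / τ * P := by gcongr
      _ ≤ C := by linarith
  have H1 : ∀ s, HasDerivAt (fun s => ∫ y, k s y * g y) (∫ y, k1 s y * g y) s := fun s =>
    (hd_int hg k k1 s 1 C one_pos hkc (hk1c s) (hb0 s) (fun s _ => hb1 s) (fun s _ => hd1 s)).2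
  obtain ⟨I2, H2⟩ :=
    (hd_int hg k1 k2 0 1 C one_pos hk1c (hk2c 0) (hb1 0) (fun s _ => hb2 s) (fun s _ => hd2 s))
  have e2 : (fun y => ((4 * (x i - y i) ^ 2 / τ ^ 2 - 2 / τ) * gk τ (x - y)) * g y)
      = fun y => k2 0 y * g y := by
    funext y; simp [k2]
  refine ⟨by rw [e2]; exact I2, fun s => ∫ y, k1 s y * g y, Eventually.of_forall fun s => ?_, ?_, ?_⟩
  · have : (fun s : ℝ => HU g τ (x + s • e)) = fun s => ∫ y, k s y * g y := by
      funext s; simp only [HU, k]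
      congr 1; funext y; congr 2; abel
    rw [this]; exact H1 s
  · simp [k1]
  · rw [e2]; exact H2

lemma HU_dt {d : ℕ} {g : EuclideanSpace ℝ (Fin d) → ℝ} (hg : Integrable g) {τ : ℝ} (hτ : 0 < τ)
    (x : EuclideanSpace ℝ (Fin d)) :
    HasDerivAt (fun τ => HU g τ x)
      (∫ y, ((‖x - y‖ ^ 2 / τ ^ 2 - d / (2 * τ)) * gk τ (x - y)) * g y) τ := by
  have hgc := fun τ => gk_continuous (d := d) τ
  let k1 : ℝ → EuclideanSpace ℝ (Fin d) → ℝ :=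
    fun s y => (‖x - y‖ ^ 2 / s ^ 2 - d / (2 * s)) * gk s (x - y)
  set Q : ℝ := (π * (τ / 2)) ^ (-(d:ℝ)/2) with hQ
  have hQpos : 0 < Q := by positivity
  set C : ℝ := Q + (Q / (τ / 2) + d / (2 * (τ / 2)) * Q) with hC
  have n2 : 0 ≤ Q / (τ / 2) + d / (2 * (τ / 2)) * Q := by positivity
  have hmono : ∀ s, τ / 2 < s → (π * s) ^ (-(d:ℝ)/2) ≤ Q := by
    intro s hs
    refine Real.rpow_le_rpow_of_nonpos (by positivity) (by gcongr) ?_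
    have : (0:ℝ) ≤ d := by positivity
    linarith
  have hball : ∀ s ∈ Metric.ball τ (τ / 2), τ / 2 < s := by
    intro s hs
    rw [Metric.mem_ball, Real.dist_eq, abs_lt] at hs
    linarith [hs.1]
  refine (hd_int hg (fun s y => gk s (x - y)) k1 τ (τ / 2) C (by positivity) ?_ ?_ ?_ ?_ ?_).2
  · intro s; have := hgc s; fun_prop
  · have := hgc τ; simp only [k1]; fun_prop
  · intro y
    rw [abs_of_pos (gk_pos hτ _)]
    have := gk_le hτ (x - y)
    have := hmono τ (by linarith)
    linarith
  · intro s hs y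
    have hs := hball s hs
    have hs0 : 0 < s := by linarith
    have h0 := gk_pos hs0 (x - y)
    have h1 := gk_le hs0 (x - y)
    have h2 := gk_normsq_le hs0 (x - y)
    have h3 := hmono s hs
    simp only [k1]
    rw [sub_mul]
    refine (abs_sub _ _).trans ?_
    rw [abs_of_nonneg (by positivity), abs_of_nonneg (by positivity)]
    calc ‖x - y‖ ^ 2 / s ^ 2 * gk s (x - y) + d / (2 * s) * gk s (x - y)
        = (‖x - y‖ ^ 2 * gk s (x - y)) / s ^ 2 + d / (2 * s) * gk s (x - y) := by ring
      _ ≤ (s * Q) / s ^ 2 + d / (2 * s) * Q := by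
          have h4 : ‖x - y‖ ^ 2 * gk s (x - y) ≤ s * Q := h2.trans (by gcongr)
          have h5 : gk s (x - y) ≤ Q := h1.trans h3
          exact add_le_add (div_le_div_of_nonneg_right h4 (by positivity))
            (mul_le_mul_of_nonneg_left h5 (by positivity))
      _ = Q / s + d / (2 * s) * Q := by field_simp
      _ ≤ Q / (τ / 2) + d / (2 * (τ / 2)) * Q := by gcongr
      _ ≤ C := by linarith
  · intro s hs y
    have hs := hball s hs
    have hs0 : 0 < s := by linarith
    have hp : HasDerivAt (fun s : ℝ => (π * s) ^ (-(d:ℝ)/2))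
        ((-(d:ℝ)/2) / s * (π * s) ^ (-(d:ℝ)/2)) s := by
      have h1 : HasDerivAt (fun s : ℝ => π * s) π s := by
        simpa using (hasDerivAt_id s).const_mul π
      have h2 := h1.rpow_const (p := -(d:ℝ)/2) (Or.inl (by positivity))
      refine h2.congr_deriv ?_
      rw [Real.rpow_sub_one (by positivity)]
      field_simp
    have he : HasDerivAt (fun s : ℝ => Real.exp (-‖x - y‖ ^ 2 / s))
        (Real.exp (-‖x - y‖ ^ 2 / s) * (‖x - y‖ ^ 2 / s ^ 2)) s := by
      have h1 := ((hasDerivAt_inv hs0.ne').const_mul (-‖x - y‖ ^ 2))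
      have h2 : HasDerivAt (fun s : ℝ => -‖x - y‖ ^ 2 / s) (‖x - y‖ ^ 2 / s ^ 2) s :=
        (h1.congr_deriv (by field_simp))
      exact h2.exp
    refine (hp.mul he).congr_deriv ?_
    simp only [k1, gk]
    field_simp
    ring

lemma HU_cont {d : ℕ} {g : EuclideanSpace ℝ (Fin d) → ℝ} (hg : Integrable g) {δ : ℝ} (hδ : 0 < δ) :
    ContinuousOn (fun p : ℝ × EuclideanSpace ℝ (Fin d) => HU g p.1 p.2) (Ici δ ×ˢ univ) := by
  have hgc := fun τ => gk_continuous (d := d) τ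
  unfold HU
  refine continuousOn_of_dominated (bound := fun y => (π * δ) ^ (-(d:ℝ)/2) * |g y|) ?_ ?_
    (hg.abs.const_mul _) ?_
  · rintro ⟨τ, x⟩ -
    refine AEStronglyMeasurable.mul ?_ hg.aestronglyMeasurable
    have := hgc τ
    exact Continuous.aestronglyMeasurable (by fun_prop)
  · rintro ⟨τ, x⟩ ⟨hτ, -⟩
    have hτ : δ ≤ τ := hτ
    refine Eventually.of_forall fun y => ?_
    have h0 : 0 < τ := by linarith
    rw [norm_mul, Real.norm_eq_abs, Real.norm_eq_abs, abs_of_pos (gk_pos h0 _)]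
    gcongr
    refine (gk_le h0 _).trans ?_
    refine Real.rpow_le_rpow_of_nonpos (by positivity) (by gcongr) ?_
    have : (0:ℝ) ≤ d := by positivity
    linarith
  · refine Eventually.of_forall fun y => ?_
    refine ContinuousOn.mul ?_ continuousOn_const
    unfold gk
    rintro ⟨τ, x⟩ ⟨hτ, -⟩
    have hτ : δ ≤ τ := hτ
    have h0 : 0 < τ := by linarith
    apply ContinuousAt.continuousWithinAt
    apply ContinuousAt.mul
    · exact ContinuousAt.rpow_const (by fun_prop) (Or.inl (by positivity))
    · exact ContinuousAt.rexp (ContinuousAt.div (by fun_prop) (by fun_prop) h0.ne')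

lemma HU_approx {d : ℕ} {g : EuclideanSpace ℝ (Fin d) → ℝ} (hg : Integrable g) {L : ℝ}
    (hL0 : 0 ≤ L) (hL : ∀ x y, |g x - g y| ≤ L * ‖x - y‖) {δ : ℝ} (hδ : 0 < δ)
    (x : EuclideanSpace ℝ (Fin d)) :
    g x ≤ HU g δ x + L * 2 ^ ((d:ℝ)/2) * √(2 * δ) := by
  set A : ℝ := 2 ^ ((d:ℝ)/2) * √(2 * δ) with hA
  have hgc := fun τ => gk_continuous (d := d) τ
  have hpt : ∀ z : EuclideanSpace ℝ (Fin d), ‖z‖ * gk δ z ≤ A * gk (2 * δ) z := by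
    intro z
    have h1 : (π * δ) ^ (-(d:ℝ)/2) = 2 ^ ((d:ℝ)/2) * (π * (2 * δ)) ^ (-(d:ℝ)/2) := by
      rw [show π * (2 * δ) = 2 * (π * δ) by ring, Real.mul_rpow (x := 2) (y := π * δ) (by norm_num) (by positivity),
        ← mul_assoc, ← Real.rpow_add (by norm_num : (0:ℝ) < 2),
        show (d:ℝ)/2 + -(d:ℝ)/2 = 0 by ring, Real.rpow_zero, one_mul]
    have h2 : ‖z‖ * Real.exp (-‖z‖ ^ 2 / δ) ≤ √(2 * δ) * Real.exp (-‖z‖ ^ 2 / (2 * δ)) := by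
      have e1 : Real.exp (-‖z‖ ^ 2 / δ)
          = Real.exp (-(‖z‖ ^ 2 / (2 * δ))) * Real.exp (-‖z‖ ^ 2 / (2 * δ)) := by
        rw [← Real.exp_add]; congr 1; field_simp; ring
      rw [e1, ← mul_assoc]
      gcongr
      have hs : 0 < √(2 * δ) := Real.sqrt_pos.2 (by positivity)
      have hs2 : √(2 * δ) ^ 2 = 2 * δ := Real.sq_sqrt (by positivity)
      rw [Real.exp_neg, ← div_eq_mul_inv, div_le_iff₀ (Real.exp_pos _)]
      have h3 := Real.add_one_le_exp (‖z‖ ^ 2 / (2 * δ))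
      have h4 : ‖z‖ ^ 2 / (2 * δ) = (‖z‖ / √(2 * δ)) ^ 2 := by rw [div_pow, hs2]
      have h5 : ‖z‖ / √(2 * δ) ≤ Real.exp (‖z‖ ^ 2 / (2 * δ)) := by
        refine le_trans ?_ h3
        rw [h4]
        nlinarith [sq_nonneg (‖z‖ / √(2 * δ) - 1), sq_nonneg (‖z‖ / √(2 * δ))]
      rw [div_le_iff₀ hs] at h5
      linarith
    unfold gk
    calc ‖z‖ * ((π * δ) ^ (-(d:ℝ)/2) * Real.exp (-‖z‖ ^ 2 / δ))
        = (π * δ) ^ (-(d:ℝ)/2) * (‖z‖ * Real.exp (-‖z‖ ^ 2 / δ)) := by ring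
      _ ≤ (π * δ) ^ (-(d:ℝ)/2) * (√(2 * δ) * Real.exp (-‖z‖ ^ 2 / (2 * δ))) := by gcongr
      _ = _ := by rw [h1, hA]; ring
  have i1 : Integrable (fun y => gk δ (x - y)) := (gk_integrable hδ).comp_sub_left x
  have i2 : Integrable (fun y => gk (2 * δ) (x - y)) :=
    (gk_integrable (by positivity : 0 < 2 * δ)).comp_sub_left x
  have i3 : Integrable (fun y => gk δ (x - y) * g y) := by
    refine hg.bdd_mul (c := (π * δ) ^ (-(d:ℝ)/2)) ?_ ?_
    · have := hgc δ
      exact Continuous.aestronglyMeasurable (by fun_prop)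
    · refine Eventually.of_forall fun y => ?_
      rw [Real.norm_eq_abs, abs_of_pos (gk_pos hδ _)]
      exact gk_le hδ _
  have m1 : ∫ y, gk δ (x - y) = 1 := by
    rw [integral_sub_left_eq_self (fun y => gk δ y) volume x, gk_integral hδ]
  have m2 : ∫ y, gk (2 * δ) (x - y) = 1 := by
    rw [integral_sub_left_eq_self (fun y => gk (2 * δ) y) volume x, gk_integral (by positivity)]
  have key : ∫ y, gk δ (x - y) * g x
      ≤ ∫ y, (gk δ (x - y) * g y + L * A * gk (2 * δ) (x - y)) := by
    refine integral_mono (i1.mul_const _) (i3.add (i2.const_mul _)) fun y => ?_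
    have h1 := hpt (x - y)
    have h2 := (abs_le.1 (hL x y)).2
    have h0 := (gk_pos hδ (x - y)).le
    have h3 : gk δ (x - y) * (g x - g y) ≤ gk δ (x - y) * (L * ‖x - y‖) := by gcongr
    have h4 : L * (‖x - y‖ * gk δ (x - y)) ≤ L * (A * gk (2 * δ) (x - y)) := by gcongr
    simp only
    nlinarith
  rw [integral_mul_const, m1, one_mul, integral_add i3 (i2.const_mul _), integral_const_mul, m2] at key
  unfold HU
  rw [hA] at key
  linarith

lemma HU_nonneg {d : ℕ} {g : EuclideanSpace ℝ (Fin d) → ℝ} (hg : ∀ x, 0 ≤ g x) {τ : ℝ}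
    (hτ : 0 < τ) (x : EuclideanSpace ℝ (Fin d)) : 0 ≤ HU g τ x :=
  integral_nonneg fun y => mul_nonneg (gk_pos hτ _).le (hg y)

lemma HU_heat {d : ℕ} {g : EuclideanSpace ℝ (Fin d) → ℝ} (hg : Integrable g) {τ : ℝ} (hτ : 0 < τ)
    (x : EuclideanSpace ℝ (Fin d)) :
    4 * (∫ y, ((‖x - y‖ ^ 2 / τ ^ 2 - d / (2 * τ)) * gk τ (x - y)) * g y)
     = ∑ i, ∫ y, ((4 * (x i - y i) ^ 2 / τ ^ 2 - 2 / τ) * gk τ (x - y)) * g y := by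
  rw [← integral_finsetSum _ (fun i _ => (HU_D2 hg hτ x i).1), ← integral_const_mul]
  congr 1; funext y
  rw [← Finset.sum_mul, ← Finset.sum_mul, EuclideanSpace.norm_sq_eq]
  rw [Finset.sum_sub_distrib, ← Finset.sum_div, ← Finset.mul_sum]
  simp
  field_simp
  ring

lemma exp_sub_one_le_abs (a B : ℝ) (h : |a| ≤ B) : Real.exp a - 1 ≤ |a| * Real.exp B := by
  have h1 := Real.add_one_le_exp (-a)
  have h2 : Real.exp a * Real.exp (-a) = 1 := by rw [← Real.exp_add]; simp
  have h3 : Real.exp a - 1 ≤ a * Real.exp a := by nlinarith [Real.exp_pos a]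
  have h4 : Real.exp a ≤ Real.exp B := Real.exp_le_exp.2 ((le_abs_self a).trans h)
  calc Real.exp a - 1 ≤ a * Real.exp a := h3
    _ ≤ |a| * Real.exp a := by gcongr; exact le_abs_self a
    _ ≤ _ := by gcongr

lemma HC {d : ℕ} {ν κ T : ℝ} (hν : 0 < ν) (hκ : 0 < κ) (v : ℝ → EuclideanSpace ℝ (Fin d) → ℝ)
    (hc : ContinuousOn (fun p : ℝ × EuclideanSpace ℝ (Fin d) => v p.1 p.2) (Icc 0 T ×ˢ univ))
    (hb : ∃ C, ∀ t ∈ Icc (0:ℝ) T, ∀ x, |v t x| ≤ C)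
    (hpde : ∀ t ∈ Ioc (0:ℝ) T, ∀ x, ∃ vt : ℝ, ∃ a b : Fin d → ℝ,
      HasDerivAt (fun s => v s x) vt t ∧
      (∀ i, D2 (fun s : ℝ => v t (x + s • EuclideanSpace.single i (1:ℝ))) (a i) (b i)) ∧
      vt ≤ ν * ∑ i, b i + κ * ∑ i, (a i) ^ 2)
    (B : ℝ) (hB : ∀ x, |v 0 x| ≤ B) :
    (∀ t ∈ Icc (0:ℝ) T, ∀ x, v t x ≤ B) ∧
    (∀ L : ℝ, 0 ≤ L → (∀ x y, |v 0 x - v 0 y| ≤ L * ‖x - y‖) → Integrable (v 0) →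
      ∀ t ∈ Ioc (0:ℝ) T, ∀ x, v t x ≤ Real.exp (κ / ν * B) * HU (fun y => |v 0 y|) (4 * ν * t) x) := by
  have hq : 0 < κ / ν := by positivity
  obtain ⟨C, hC⟩ := hb
  let w : ℝ → EuclideanSpace ℝ (Fin d) → ℝ := fun t x => Real.exp (κ / ν * v t x)
  have hwc : ContinuousOn (fun p : ℝ × EuclideanSpace ℝ (Fin d) => w p.1 p.2) (Icc 0 T ×ˢ univ) :=
    (continuousOn_const.mul hc).rexp
  have hwb : ∀ t ∈ Icc (0:ℝ) T, ∀ x, w t x ≤ Real.exp (κ / ν * C) := by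
    intro t ht x
    refine Real.exp_le_exp.2 ?_
    gcongr
    exact (le_abs_self _).trans (hC t ht x)
  have hw : ∀ t ∈ Ioc (0:ℝ) T, ∀ x, ∃ ft : ℝ, ∃ a b : Fin d → ℝ,
      HasDerivAt (fun s => w s x) ft t ∧
      (∀ i, D2 (fun s : ℝ => w t (x + s • EuclideanSpace.single i (1:ℝ))) (a i) (b i)) ∧
      ft ≤ ν * ∑ i, b i := by
    intro t ht x
    obtain ⟨vt, a, b, h1, h2, h3⟩ := hpde t ht x
    refine ⟨_, _, _, (h1.const_mul (κ / ν)).exp, fun i => ((h2 i).const_mul (κ / ν)).exp, ?_⟩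
    simp only [zero_smul, add_zero]
    rw [← Finset.sum_mul, Finset.sum_add_distrib, ← Finset.mul_sum]
    simp only [mul_pow]
    rw [← Finset.mul_sum]
    have : ν * ((κ / ν * ∑ i, b i + (κ / ν) ^ 2 * ∑ i, a i ^ 2) * Real.exp (κ / ν * v t x))
      = Real.exp (κ / ν * v t x) * (κ / ν * (ν * ∑ i, b i + κ * ∑ i, a i ^ 2)) := by
      field_simp
    rw [this]
    gcongr
  constructor
  · intro t ht x
    have := maxPrinciple hν.le w hwc ⟨_, hwb⟩ hw (Real.exp (κ / ν * B))
      (fun x => Real.exp_le_exp.2 (by gcongr; exact (le_abs_self _).trans (hB x))) t ht x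
    have := Real.exp_le_exp.1 this
    exact le_of_mul_le_mul_left this hq
  · intro L hL0 hL hint t ht x
    set g : EuclideanSpace ℝ (Fin d) → ℝ := fun y => |v 0 y| with hg
    have hgi : Integrable g := hint.abs
    have hgL : ∀ x y, |g x - g y| ≤ L * ‖x - y‖ := fun x y =>
      (abs_abs_sub_abs_le _ _).trans (hL x y)
    have hg0 : ∀ x, 0 ≤ g x := fun x => abs_nonneg _
    set P : ℝ := κ / ν * Real.exp (κ / ν * B) with hP
    have hPpos : 0 < P := by positivity
    have key : ∀ δ : ℝ, 0 < δ → w t x ≤ P * HU g (4 * ν * t + δ) x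
        + (1 + P * (L * 2 ^ ((d:ℝ)/2) * √(2 * δ))) := by
      intro δ hδ
      have hτ : ∀ t, 0 ≤ t → 0 < 4 * ν * t + δ := fun t ht => by positivity
      have := maxPrinciple (T := T) hν.le (fun t x => w t x - P * HU g (4 * ν * t + δ) x) ?_
        ⟨Real.exp (κ / ν * C), ?_⟩ ?_ (1 + P * (L * 2 ^ ((d:ℝ)/2) * √(2 * δ))) ?_ t ⟨ht.1.le, ht.2⟩ x
      · linarith
      · refine hwc.sub (continuousOn_const.mul ?_)
        refine (HU_cont hgi hδ).comp (f := fun p : ℝ × EuclideanSpace ℝ (Fin d) =>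
          (4 * ν * p.1 + δ, p.2)) (by fun_prop) ?_
        rintro ⟨t, x⟩ ⟨ht, -⟩
        refine ⟨?_, mem_univ _⟩
        have := ht.1
        simp only [mem_Ici, le_add_iff_nonneg_left]
        exact mul_nonneg (by positivity) this
      · intro t ht x
        have h1 := hwb t ht x
        have h2 := HU_nonneg hg0 (hτ t ht.1) x
        have : 0 ≤ P * HU g (4 * ν * t + δ) x := by positivity
        linarith
      · intro t ht x
        obtain ⟨ft, a, b, h1, h2, h3⟩ := hw t ht x
        have hτt := hτ t ht.1.le
        have hlin : HasDerivAt (fun s : ℝ => 4 * ν * s + δ) (4 * ν) t := by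
          simpa using ((hasDerivAt_id t).const_mul (4 * ν)).add_const δ
        have hU := HasDerivAt.comp t (h₂ := fun τ => HU g τ x) (h := fun s => 4 * ν * s + δ)
          (HU_dt hgi hτt x) hlin
        refine ⟨_, _, _, h1.sub (hU.const_mul P),
          fun i => (h2 i).sub ((HU_D2 hgi hτt x i).2.const_mul P), ?_⟩
        rw [Finset.sum_sub_distrib, ← Finset.mul_sum, ← HU_heat hgi hτt x]
        linarith
      · intro x
        have h1 := HU_approx hgi hL0 hgL hδ x
        have h2 := exp_sub_one_le_abs (κ / ν * v 0 x) (κ / ν * B) (by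
          rw [abs_mul, abs_of_pos hq]; gcongr; exact hB x)
        rw [abs_mul, abs_of_pos hq] at h2
        have h3 : P * g x ≤ P * (HU g δ x + L * 2 ^ ((d:ℝ)/2) * √(2 * δ)) := by gcongr
        have h4 : κ / ν * |v 0 x| * Real.exp (κ / ν * B) = P * g x := by rw [hP, hg]; ring
        simp only [mul_zero, zero_add, w]
        linarith
    have ht4 : 0 < 4 * ν * t := by have := ht.1; positivity
    have hlim : Tendsto (fun δ : ℝ => P * HU g (4 * ν * t + δ) x
        + (1 + P * (L * 2 ^ ((d:ℝ)/2) * √(2 * δ)))) (𝓝[>] 0)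
        (𝓝 (P * HU g (4 * ν * t + 0) x + (1 + P * (L * 2 ^ ((d:ℝ)/2) * √(2 * 0))))) := by
      refine Tendsto.mono_left ?_ nhdsWithin_le_nhds
      apply ContinuousAt.tendsto
        (f := fun δ : ℝ => P * HU g (4 * ν * t + δ) x + (1 + P * (L * 2 ^ ((d:ℝ)/2) * √(2 * δ))))
      have h1 : ContinuousAt (fun τ => HU g τ x) (4 * ν * t + 0) := by
        rw [add_zero]; exact (HU_dt hgi ht4 x).continuousAt
      have h2 : ContinuousAt (fun δ : ℝ => HU g (4 * ν * t + δ) x) 0 :=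
        ContinuousAt.comp (f := fun δ : ℝ => 4 * ν * t + δ) h1 (by fun_prop)
      fun_prop
    have hfin := ge_of_tendsto hlim (by
      filter_upwards [self_mem_nhdsWithin] with δ hδ using key δ hδ)
    simp only [add_zero, mul_zero, Real.sqrt_zero] at hfin
    have h5 := Real.add_one_le_exp (κ / ν * v t x)
    have h6 : κ / ν * v t x ≤ κ / ν * (Real.exp (κ / ν * B) * HU g (4 * ν * t) x) := by
      have : w t x = Real.exp (κ / ν * v t x) := rfl
      rw [hP] at hfin
      linarith
    exact le_of_mul_le_mul_left h6 hq


lemma sum_inner_sq {d : ℕ} (p : EuclideanSpace ℝ (Fin d)) :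
    ∑ i, (inner ℝ p (EuclideanSpace.single i (1:ℝ))) ^ 2 = ‖p‖ ^ 2 := by
  rw [EuclideanSpace.norm_sq_eq]
  refine Finset.sum_congr rfl fun i _ => ?_
  rw [EuclideanSpace.inner_single_right]; simp

lemma sol_zero {d : ℕ} {ν lam T : ℝ} {V : EuclideanSpace ℝ (Fin d) → ℝ}
    {h₀ : EuclideanSpace ℝ (Fin d) → ℝ} {h : ℝ → EuclideanSpace ℝ (Fin d) → ℝ}
    (hs : IsClassicalSolution ν lam T V h₀ h) : h 0 = h₀ := funext hs.init

lemma sol_hasDeriv {d : ℕ} {ν lam T : ℝ} {V : EuclideanSpace ℝ (Fin d) → ℝ}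
    {h₀ : EuclideanSpace ℝ (Fin d) → ℝ} {h : ℝ → EuclideanSpace ℝ (Fin d) → ℝ}
    (hs : IsClassicalSolution ν lam T V h₀ h) {t : ℝ} (ht : t ∈ Ioc (0:ℝ) T)
    (x : EuclideanSpace ℝ (Fin d)) :
    HasDerivAt (fun s => h s x) (ν * lapl (h t) x + lam * V (gradient (h t) x)) t := by
  have := (hs.time_reg x t ht).hasDerivAt
  rwa [hs.pde t ht x] at this

lemma V_bounds {d : ℕ} {V : EuclideanSpace ℝ (Fin d) → ℝ} {W : ℝ → ℝ}
    (hV : IsDepositionRate d V W) (p : EuclideanSpace ℝ (Fin d)) : 0 ≤ V p ∧ V p ≤ ‖p‖ ^ 2 := by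
  rw [hV.isotropic]
  exact ⟨hV.nonneg _ (norm_nonneg _), hV.quadGrowth _ (norm_nonneg _)⟩

lemma sol_abs {d : ℕ} {ν lam T M L : ℝ} {V : EuclideanSpace ℝ (Fin d) → ℝ} {W : ℝ → ℝ}
    {h₀ : EuclideanSpace ℝ (Fin d) → ℝ} {h : ℝ → EuclideanSpace ℝ (Fin d) → ℝ}
    (hν : 0 < ν) (hlam : 0 < lam) (hV : IsDepositionRate d V W)
    (hs : IsClassicalSolution ν lam T V h₀ h) (hM : ∀ x, |h₀ x| ≤ M) (hL0 : 0 ≤ L)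
    (hL : ∀ x y, |h₀ x - h₀ y| ≤ L * ‖x - y‖) (hi : Integrable h₀) :
    (∀ t ∈ Icc (0:ℝ) T, ∀ x, |h t x| ≤ M) ∧
    (∀ t ∈ Ioc (0:ℝ) T, ∀ x,
      |h t x| ≤ Real.exp (lam / ν * M) * HU (fun y => |h₀ y|) (4 * ν * t) x) := by
  have h0 := sol_zero hs
  obtain ⟨C, hC⟩ := hs.bdd
  have A := HC hν hlam h hs.cont hs.bdd (fun t ht x => ⟨_, _, _, sol_hasDeriv hs ht x,
    fun i => D2_contDiff (hs.space_reg t ht) x _, by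
      rw [sum_inner_sq]
      have := (V_bounds hV (gradient (h t) x)).2
      unfold lapl
      gcongr⟩) M (by rw [h0]; exact hM)
  have B := HC hν hlam (fun t x => (-1) * h t x) (continuousOn_const.mul hs.cont)
    ⟨C, fun t ht x => by simpa using hC t ht x⟩ (fun t ht x => ⟨_, _, _,
      (sol_hasDeriv hs ht x).const_mul (-1),
    fun i => (D2_contDiff (hs.space_reg t ht) x _).const_mul (-1), by
      rw [← Finset.mul_sum]
      have h1 := (V_bounds hV (gradient (h t) x)).1
      have h2 : 0 ≤ lam * V (gradient (h t) x) := by positivity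
      have h3 : 0 ≤ lam * ∑ i, ((-1) * inner ℝ (gradient (h t) x) (EuclideanSpace.single i (1:ℝ))) ^ 2 := by
        positivity
      unfold lapl
      linarith⟩) M (fun x => by rw [h0]; simpa using hM x)
  obtain ⟨A1, A2⟩ := A
  obtain ⟨B1, B2⟩ := B
  rw [h0] at A2 B2
  constructor
  · intro t ht x
    have := A1 t ht x
    have := B1 t ht x
    exact abs_le.2 ⟨by linarith, by linarith⟩
  · intro t ht x
    have a := A2 L hL0 hL hi t ht x
    have b := B2 L hL0 (fun x y => by
      have := hL x y
      rw [← abs_neg] at this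
      convert this using 2; ring) (hi.const_mul (-1)) t ht x
    simp only [neg_mul, one_mul, abs_neg] at b
    exact abs_le.2 ⟨by linarith, by linarith⟩

lemma sol_shift {d : ℕ} {ν lam T L B μ : ℝ} {V : EuclideanSpace ℝ (Fin d) → ℝ} {W : ℝ → ℝ}
    {h₀ : EuclideanSpace ℝ (Fin d) → ℝ} {h : ℝ → EuclideanSpace ℝ (Fin d) → ℝ}
    (hν : 0 < ν) (hlam : 0 < lam) (hV : IsDepositionRate d V W)
    (hs : IsClassicalSolution ν lam T V h₀ h) (hL0 : 0 ≤ L)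
    (hL : ∀ x y, |h₀ x - h₀ y| ≤ L * ‖x - y‖) (hi : Integrable h₀)
    (z : EuclideanSpace ℝ (Fin d)) (hμ0 : 0 < μ) (hμ1 : μ < 1)
    (hB : ∀ x, |(1 - μ)⁻¹ * (h₀ (x + z) - μ * h₀ x)| ≤ B) {t : ℝ} (ht : t ∈ Ioc (0:ℝ) T)
    (x : EuclideanSpace ℝ (Fin d)) :
    (1 - μ)⁻¹ * (h t (x + z) - μ * h t x) ≤ Real.exp (lam / ν * B) *
      HU (fun y => |(1 - μ)⁻¹ * (h₀ (y + z) - μ * h₀ y)|) (4 * ν * t) x := by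
  have h0 := sol_zero hs
  obtain ⟨C, hC⟩ := hs.bdd
  have hm : 0 < 1 - μ := by linarith
  set k := (1 - μ)⁻¹ with hk
  have hkpos : 0 < k := by positivity
  have hkm : k * (1 - μ) = 1 := by rw [hk]; field_simp
  have A := HC hν hlam (T := T) (fun t x => k * (h t (x + z) - μ * h t x)) ?_
    ⟨k * (C + μ * C), ?_⟩ ?_ B (by rw [h0]; exact hB)
  · have A2 := A.2 (k * (L + μ * L)) (by positivity) ?_ ?_ t ht x
    · simpa only [h0] using A2
    · intro x y
      simp only [h0]
      have h1 := hL (x + z) (y + z)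
      have h2 := hL x y
      rw [add_sub_add_right_eq_sub] at h1
      rw [← mul_sub, abs_mul, abs_of_pos hkpos, mul_assoc]
      gcongr
      rw [show h₀ (x + z) - μ * h₀ x - (h₀ (y + z) - μ * h₀ y)
        = (h₀ (x + z) - h₀ (y + z)) - μ * (h₀ x - h₀ y) by ring]
      refine (abs_sub _ _).trans ?_
      rw [abs_mul, abs_of_pos hμ0, add_mul, mul_assoc]
      gcongr
    · simp only [h0]
      exact ((hi.comp_add_right z).sub (hi.const_mul μ)).const_mul k
  · refine continuousOn_const.mul (ContinuousOn.sub ?_ (continuousOn_const.mul hs.cont))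
    refine hs.cont.comp (f := fun p : ℝ × EuclideanSpace ℝ (Fin d) => (p.1, p.2 + z))
      (by fun_prop) ?_
    rintro ⟨t, x⟩ ⟨h1, -⟩
    exact ⟨h1, mem_univ _⟩
  · intro t ht x
    rw [abs_mul, abs_of_pos hkpos]
    gcongr
    refine (abs_sub _ _).trans ?_
    rw [abs_mul, abs_of_pos hμ0]
    gcongr
    · exact hC t ht _
    · exact hC t ht _
  · intro t ht x
    have e : ∀ i, (fun s : ℝ => h t (x + s • EuclideanSpace.single i (1:ℝ) + z))
        = fun s : ℝ => h t (x + z + s • EuclideanSpace.single i (1:ℝ)) := by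
      intro i; funext s; congr 1; abel
    refine ⟨_, fun i => k * (inner ℝ (gradient (h t) (x + z)) (EuclideanSpace.single i (1:ℝ)) -
        μ * inner ℝ (gradient (h t) x) (EuclideanSpace.single i (1:ℝ))),
      fun i => k * (iteratedFDeriv ℝ 2 (h t) (x + z)
          ![EuclideanSpace.single i (1:ℝ), EuclideanSpace.single i (1:ℝ)] -
        μ * iteratedFDeriv ℝ 2 (h t) x
          ![EuclideanSpace.single i (1:ℝ), EuclideanSpace.single i (1:ℝ)]),
      ((sol_hasDeriv hs ht (x + z)).sub
      ((sol_hasDeriv hs ht x).const_mul μ)).const_mul k, fun i => ?_, ?_⟩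
    · refine D2.const_mul k (D2.sub ?_ ((D2_contDiff (hs.space_reg t ht) x _).const_mul μ))
      rw [e i]
      exact D2_contDiff (hs.space_reg t ht) (x + z) _
    · set p := gradient (h t) (x + z)
      set q := gradient (h t) x
      have e1 : ∀ i, k * (inner ℝ p (EuclideanSpace.single i (1:ℝ)) -
        μ * inner ℝ q (EuclideanSpace.single i (1:ℝ))) =
          inner ℝ (k • (p - μ • q)) (EuclideanSpace.single i (1:ℝ)) := by
        intro i
        rw [real_inner_smul_left, inner_sub_left, real_inner_smul_left]
      simp only [e1]
      rw [sum_inner_sq, ← Finset.mul_sum, Finset.sum_sub_distrib, ← Finset.mul_sum]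
      have h1 := hV.convex.2 (mem_univ q) (mem_univ (k • (p - μ • q))) hμ0.le hm.le (by ring)
      rw [smul_smul, mul_comm (1 - μ) k, hkm, one_smul, add_sub_cancel] at h1
      have h2 := (V_bounds hV (k • (p - μ • q))).2
      simp only [smul_eq_mul] at h1
      have h3 : k * (V p - μ * V q) ≤ V (k • (p - μ • q)) := by
        calc k * (V p - μ * V q) ≤ k * ((1 - μ) * V (k • (p - μ • q))) := by
              gcongr; linarith
          _ = _ := by rw [← mul_assoc, hkm, one_mul]
      have h4 : lam * (k * (V p - μ * V q)) ≤ lam * ‖k • (p - μ • q)‖ ^ 2 := by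
        gcongr; linarith
      unfold lapl
      linarith

lemma gk_mul_integrable {d : ℕ} {g : EuclideanSpace ℝ (Fin d) → ℝ} (hg : Integrable g) {τ : ℝ}
    (hτ : 0 < τ) (x : EuclideanSpace ℝ (Fin d)) : Integrable (fun y => gk τ (x - y) * g y) := by
  refine hg.bdd_mul (c := (π * τ) ^ (-(d:ℝ)/2)) ?_ (Eventually.of_forall fun y => ?_)
  · exact ((gk_continuous τ).comp (by fun_prop : Continuous fun y => x - y)).aestronglyMeasurable
  · rw [Real.norm_eq_abs, abs_of_pos (gk_pos hτ _)]; exact gk_le hτ _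

lemma HU_lintegral {d : ℕ} {g : EuclideanSpace ℝ (Fin d) → ℝ} (hg : Integrable g)
    (hg0 : ∀ x, 0 ≤ g x) {τ : ℝ} (hτ : 0 < τ) :
    ∫⁻ x, ENNReal.ofReal (HU g τ x) ≤ ENNReal.ofReal (∫ x, g x) := by
  have h1 : ∀ x, ENNReal.ofReal (HU g τ x)
      = ∫⁻ y, ENNReal.ofReal (gk τ (x - y)) * ENNReal.ofReal (g y) := by
    intro x
    unfold HU
    rw [ofReal_integral_eq_lintegral_ofReal (gk_mul_integrable hg hτ x)
      (Eventually.of_forall fun y => mul_nonneg (gk_pos hτ _).le (hg0 y))]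
    refine lintegral_congr fun y => ?_
    rw [ENNReal.ofReal_mul (gk_pos hτ _).le]
  simp only [h1]
  have hm : Measurable (fun p : EuclideanSpace ℝ (Fin d) × EuclideanSpace ℝ (Fin d) =>
      ENNReal.ofReal (gk τ (p.1 - p.2))) :=
    (ENNReal.continuous_ofReal.comp ((gk_continuous τ).comp
      (continuous_fst.sub continuous_snd))).measurable
  rw [lintegral_lintegral_swap]
  · rw [ofReal_integral_eq_lintegral_ofReal hg (Eventually.of_forall hg0)]
    refine lintegral_mono fun y => ?_
    simp only
    rw [lintegral_mul_const' _ _ ENNReal.ofReal_ne_top]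
    rw [lintegral_sub_right_eq_self (fun x => ENNReal.ofReal (gk τ x)) y]
    rw [← ofReal_integral_eq_lintegral_ofReal (gk_integrable hτ)
      (Eventually.of_forall fun y => (gk_pos hτ _).le), gk_integral hτ]
    simp
  · exact hm.aemeasurable.mul hg.aemeasurable.ennreal_ofReal.comp_snd

lemma line_hasDeriv {d : ℕ} {f : EuclideanSpace ℝ (Fin d) → ℝ} {x : EuclideanSpace ℝ (Fin d)}
    (hf : DifferentiableAt ℝ f x) (e : EuclideanSpace ℝ (Fin d)) :
    HasDerivAt (fun s : ℝ => f (x + s • e)) (inner ℝ (gradient f x) e) 0 := by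
  have hline : HasDerivAt (fun s : ℝ => x + s • e) e 0 := by
    simpa using ((hasDerivAt_id (0:ℝ)).smul_const e).const_add x
  have h1 : HasFDerivAt f (fderiv ℝ f x) (x + (0:ℝ) • e) := by simpa using hf.hasFDerivAt
  have := h1.comp_hasDerivAt (0:ℝ) hline
  exact this.congr_deriv (by simp [gradient])

lemma slope_tendsto {d : ℕ} {f : EuclideanSpace ℝ (Fin d) → ℝ} {x : EuclideanSpace ℝ (Fin d)}
    (hf : DifferentiableAt ℝ f x) (e : EuclideanSpace ℝ (Fin d)) {a : ℝ} (ha : 0 < a) :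
    Tendsto (fun s : ℝ => (1 - (1 - a * s))⁻¹ * (f (x + s • e) - (1 - a * s) * f x)) (𝓝[>] 0)
      (𝓝 (a⁻¹ * inner ℝ (gradient f x) e + f x)) := by
  have h1 := (hasDerivAt_iff_tendsto_slope_zero.1 (line_hasDeriv hf e)).mono_left
    (nhdsWithin_mono _ (fun x (hx : (0:ℝ) < x) => ne_of_gt hx))
  refine ((h1.const_mul a⁻¹).add_const (f x)).congr' ?_
  filter_upwards [self_mem_nhdsWithin] with s hs
  have hs : 0 < s := hs
  simp only [zero_add, zero_smul, add_zero, smul_eq_mul, sub_sub_cancel]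
  field_simp
  ring

lemma sol_dir {d : ℕ} {ν lam T L M a : ℝ} {V : EuclideanSpace ℝ (Fin d) → ℝ} {W : ℝ → ℝ}
    {h₀ : EuclideanSpace ℝ (Fin d) → ℝ} {h : ℝ → EuclideanSpace ℝ (Fin d) → ℝ}
    (hν : 0 < ν) (hlam : 0 < lam) (hV : IsDepositionRate d V W)
    (hs : IsClassicalSolution ν lam T V h₀ h) (hL0 : 0 ≤ L)
    (hL : ∀ x y, |h₀ x - h₀ y| ≤ L * ‖x - y‖) (hi : Integrable h₀)
    (hM : ∀ x, |h₀ x| ≤ M) (hd0 : Differentiable ℝ h₀)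
    (hgi : Integrable (fun x => gradient h₀ x)) (ha : 0 < a)
    (e : EuclideanSpace ℝ (Fin d)) (he : ‖e‖ ≤ 1)
    {t : ℝ} (ht : t ∈ Ioc (0:ℝ) T) (x : EuclideanSpace ℝ (Fin d)) :
    inner ℝ (gradient (h t) x) e ≤ a * |h t x| + Real.exp (lam / ν * (L / a + M)) *
      HU (fun y => ‖gradient h₀ y‖ + a * |h₀ y|) (4 * ν * t) x := by
  have ht4 : 0 < 4 * ν * t := by have := ht.1; positivity
  set P := Real.exp (lam / ν * (L / a + M)) with hP
  have hbd : ∀ s : ℝ, 0 < s → ∀ y,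
      |(1 - (1 - a * s))⁻¹ * (h₀ (y + s • e) - (1 - a * s) * h₀ y)| ≤ L / a + M := by
    intro s hs y
    have h1 := hL (y + s • e) y
    rw [add_sub_cancel_left, norm_smul, Real.norm_eq_abs, abs_of_pos hs] at h1
    have h2 : (1 - (1 - a * s))⁻¹ * (h₀ (y + s • e) - (1 - a * s) * h₀ y)
        = (a * s)⁻¹ * (h₀ (y + s • e) - h₀ y) + h₀ y := by
      rw [sub_sub_cancel]; field_simp; ring
    rw [h2]
    refine (abs_add_le _ _).trans (add_le_add ?_ (hM y))
    rw [abs_mul, abs_of_pos (by positivity : 0 < (a * s)⁻¹)]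
    calc (a * s)⁻¹ * |h₀ (y + s • e) - h₀ y| ≤ (a * s)⁻¹ * (L * (s * 1)) := by
          gcongr; exact h1.trans (by gcongr)
      _ = L / a := by field_simp
  have key : ∀ᶠ s : ℝ in 𝓝[>] 0,
      (1 - (1 - a * s))⁻¹ * (h t (x + s • e) - (1 - a * s) * h t x) ≤ P *
      HU (fun y => |(1 - (1 - a * s))⁻¹ * (h₀ (y + s • e) - (1 - a * s) * h₀ y)|) (4 * ν * t) x := by
    filter_upwards [Ioo_mem_nhdsGT (by positivity : 0 < 1 / a)] with s hs'
    have h1 : a * s < 1 := by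
      have := hs'.2
      rwa [lt_div_iff₀ ha, mul_comm] at this
    have h2 : 0 < a * s := mul_pos ha hs'.1
    exact sol_shift hν hlam hV hs hL0 hL hi (s • e) (by linarith) (by linarith)
      (hbd s hs'.1) ht x
  have lim1 := slope_tendsto ((hs.space_reg t ht).differentiable (by norm_num) x) e ha
  have lim2 : Tendsto (fun s : ℝ => HU (fun y => |(1 - (1 - a * s))⁻¹ *
      (h₀ (y + s • e) - (1 - a * s) * h₀ y)|) (4 * ν * t) x) (𝓝[>] 0)
      (𝓝 (HU (fun y => |a⁻¹ * inner ℝ (gradient h₀ y) e + h₀ y|) (4 * ν * t) x)) := by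
    unfold HU
    refine tendsto_integral_filter_of_dominated_convergence
      (fun y => gk (4 * ν * t) (x - y) * (L / a + M)) ?_ ?_ ?_ ?_
    · refine Eventually.of_forall fun s => ?_
      have h1 := gk_continuous (d := d) (4 * ν * t)
      have h2 := hd0.continuous
      refine Continuous.aestronglyMeasurable ?_
      fun_prop
    · filter_upwards [self_mem_nhdsWithin] with s hs'
      refine Eventually.of_forall fun y => ?_
      rw [norm_mul, Real.norm_eq_abs, Real.norm_eq_abs, abs_abs, abs_of_pos (gk_pos ht4 _)]
      exact mul_le_mul_of_nonneg_left (hbd s hs' y) (gk_pos ht4 _).le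
    · exact ((gk_integrable ht4).comp_sub_left x).mul_const _
    · refine Eventually.of_forall fun y => ?_
      exact ((slope_tendsto (hd0 y) e ha).abs).const_mul _
  have hfin := le_of_tendsto_of_tendsto lim1 (lim2.const_mul P) key
  have hmono : HU (fun y => |a⁻¹ * inner ℝ (gradient h₀ y) e + h₀ y|) (4 * ν * t) x
      ≤ a⁻¹ * HU (fun y => ‖gradient h₀ y‖ + a * |h₀ y|) (4 * ν * t) x := by
    unfold HU
    rw [← integral_const_mul]
    have hint : Integrable (fun y => ‖gradient h₀ y‖ + a * |h₀ y|) :=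
      hgi.norm.add (hi.abs.const_mul a)
    have hint' : Integrable (fun y => |a⁻¹ * inner ℝ (gradient h₀ y) e + h₀ y|) :=
      (((hgi.inner_const e).const_mul a⁻¹).add hi).abs
    refine integral_mono (gk_mul_integrable hint' ht4 x)
      ((gk_mul_integrable hint ht4 x).const_mul _) fun y => ?_
    simp only
    have h1 : |inner ℝ (gradient h₀ y) e| ≤ ‖gradient h₀ y‖ :=
      (abs_real_inner_le_norm _ _).trans (mul_le_of_le_one_right (norm_nonneg _) he)
    have h2 : |a⁻¹ * inner ℝ (gradient h₀ y) e + h₀ y| ≤ a⁻¹ * (‖gradient h₀ y‖ + a * |h₀ y|) := by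
      refine (abs_add_le _ _).trans ?_
      rw [abs_mul, abs_of_pos (by positivity : 0 < a⁻¹), mul_add, ← mul_assoc,
        inv_mul_cancel₀ ha.ne', one_mul]
      gcongr
    have := mul_le_mul_of_nonneg_left h2 (gk_pos ht4 (x - y)).le
    linarith
  have hPpos : 0 < P := Real.exp_pos _
  have h5 : a⁻¹ * inner ℝ (gradient (h t) x) e + h t x ≤
      P * (a⁻¹ * HU (fun y => ‖gradient h₀ y‖ + a * |h₀ y|) (4 * ν * t) x) :=
    hfin.trans (by gcongr)
  have h6 := mul_le_mul_of_nonneg_left h5 ha.le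
  have h7 : a * (a⁻¹ * inner ℝ (gradient (h t) x) e + h t x)
     = inner ℝ (gradient (h t) x) e + a * h t x := by field_simp
  have h8 : a * (P * (a⁻¹ * HU (fun y => ‖gradient h₀ y‖ + a * |h₀ y|) (4 * ν * t) x))
     = P * HU (fun y => ‖gradient h₀ y‖ + a * |h₀ y|) (4 * ν * t) x := by field_simp
  rw [h7, h8] at h6
  have h9 : -(a * h t x) ≤ a * |h t x| := by
    have := mul_le_mul_of_nonneg_left (neg_abs_le (h t x)) ha.le
    linarith
  linarith

lemma sol_grad {d : ℕ} {ν lam T L M a : ℝ} {V : EuclideanSpace ℝ (Fin d) → ℝ} {W : ℝ → ℝ}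
    {h₀ : EuclideanSpace ℝ (Fin d) → ℝ} {h : ℝ → EuclideanSpace ℝ (Fin d) → ℝ}
    (hν : 0 < ν) (hlam : 0 < lam) (hV : IsDepositionRate d V W)
    (hs : IsClassicalSolution ν lam T V h₀ h) (hL0 : 0 ≤ L)
    (hL : ∀ x y, |h₀ x - h₀ y| ≤ L * ‖x - y‖) (hi : Integrable h₀)
    (hM : ∀ x, |h₀ x| ≤ M) (hd0 : Differentiable ℝ h₀)
    (hgi : Integrable (fun x => gradient h₀ x)) (ha : 0 < a)
    {t : ℝ} (ht : t ∈ Ioc (0:ℝ) T) :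
    ∫⁻ x, ENNReal.ofReal ‖gradient (h t) x‖ ≤ ENNReal.ofReal
      (2 * Real.exp (lam / ν * (L / a + M)) * ((∫ x, ‖gradient h₀ x‖) + a * ∫ x, |h₀ x|)) := by
  have ht4 : 0 < 4 * ν * t := by have := ht.1; positivity
  set P := Real.exp (lam / ν * (L / a + M)) with hP
  set g : EuclideanSpace ℝ (Fin d) → ℝ := fun y => ‖gradient h₀ y‖ + a * |h₀ y| with hg
  have hint : Integrable g := hgi.norm.add (hi.abs.const_mul a)
  have hg0 : ∀ x, 0 ≤ g x := fun x => by positivity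
  have hpt : ∀ x, ‖gradient (h t) x‖ ≤ 2 * P * HU g (4 * ν * t) x := by
    intro x
    have h1 : ‖gradient (h t) x‖ ≤ a * |h t x| + P * HU g (4 * ν * t) x := by
      by_cases h0 : gradient (h t) x = 0
      · rw [h0, norm_zero]
        have := HU_nonneg hg0 ht4 x
        have : 0 < P := Real.exp_pos _
        positivity
      · have hn : 0 < ‖gradient (h t) x‖ := norm_pos_iff.2 h0
        have := sol_dir hν hlam hV hs hL0 hL hi hM hd0 hgi ha
          (‖gradient (h t) x‖⁻¹ • gradient (h t) x)
          (by rw [norm_smul, norm_inv, norm_norm, inv_mul_cancel₀ hn.ne']) ht x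
        rw [inner_smul_right, real_inner_self_eq_norm_sq] at this
        have h2 : ‖gradient (h t) x‖⁻¹ * ‖gradient (h t) x‖ ^ 2 = ‖gradient (h t) x‖ := by
          field_simp
        rw [h2] at this
        exact this
    have h2 := (sol_abs hν hlam hV hs hM hL0 hL hi).2 t ht x
    have h3 : Real.exp (lam / ν * M) ≤ P := by
      rw [hP]; gcongr
      have : 0 ≤ L / a := by positivity
      linarith
    have h4 : a * HU (fun y => |h₀ y|) (4 * ν * t) x ≤ HU g (4 * ν * t) x := by
      unfold HU
      rw [← integral_const_mul]
      refine integral_mono ((gk_mul_integrable hi.abs ht4 x).const_mul _)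
        (gk_mul_integrable hint ht4 x) fun y => ?_
      simp only [hg]
      have := mul_nonneg (gk_pos ht4 (x - y)).le (norm_nonneg (gradient h₀ y))
      linarith
    have h5 := HU_nonneg (fun x => abs_nonneg (h₀ x)) ht4 x
    have hPpos : 0 < P := Real.exp_pos _
    have h6 : a * |h t x| ≤ P * HU g (4 * ν * t) x := by
      calc a * |h t x| ≤ a * (P * HU (fun y => |h₀ y|) (4 * ν * t) x) := by
            gcongr; exact h2.trans (by gcongr)
        _ = P * (a * HU (fun y => |h₀ y|) (4 * ν * t) x) := by ring
        _ ≤ _ := by gcongr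
    linarith
  have hPpos : 0 < P := Real.exp_pos _
  calc ∫⁻ x, ENNReal.ofReal ‖gradient (h t) x‖
      ≤ ∫⁻ x, ENNReal.ofReal (2 * P) * ENNReal.ofReal (HU g (4 * ν * t) x) := by
        refine lintegral_mono fun x => ?_
        rw [← ENNReal.ofReal_mul (by positivity)]
        exact ENNReal.ofReal_le_ofReal (hpt x)
    _ = ENNReal.ofReal (2 * P) * ∫⁻ x, ENNReal.ofReal (HU g (4 * ν * t) x) :=
        lintegral_const_mul' _ _ ENNReal.ofReal_ne_top
    _ ≤ ENNReal.ofReal (2 * P) * ENNReal.ofReal (∫ x, g x) := by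
        gcongr; exact HU_lintegral hint hg0 ht4
    _ = _ := by
        rw [← ENNReal.ofReal_mul (by positivity), hg,
          integral_add hgi.norm (hi.abs.const_mul a), integral_const_mul]

/-- Concave modulus. -/
def ph (α β r : ℝ) : ℝ := (1 / β) * Real.log (1 + β / α * r)

lemma ph_mono {α β r s : ℝ} (hα : 0 < α) (hβ : 0 < β) (hr : 0 ≤ r) (hrs : r ≤ s) :
    ph α β r ≤ ph α β s := by
  unfold ph
  have : 0 < 1 + β / α * r := by positivity
  gcongr

lemma ph_nonneg {α β r : ℝ} (hα : 0 < α) (hβ : 0 < β) (hr : 0 ≤ r) : 0 ≤ ph α β r := by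
  have := ph_mono hα hβ le_rfl hr
  simpa [ph] using this

lemma ph_le {α β r : ℝ} (hα : 0 < α) (hβ : 0 < β) (hr : 0 ≤ r) : ph α β r ≤ r / α := by
  unfold ph
  have h1 : 0 < 1 + β / α * r := by positivity
  have := Real.log_le_sub_one_of_pos h1
  calc (1 / β) * Real.log (1 + β / α * r) ≤ (1 / β) * (1 + β / α * r - 1) := by gcongr
    _ = r / α := by field_simp; ring

lemma ph_deriv {α β r : ℝ} (hα : 0 < α) (hβ : 0 < β) (hr : 0 < α + β * r) :
    HasDerivAt (ph α β) (1 / (α + β * r)) r := by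
  have h0 : 1 + β / α * r = (α + β * r) / α := by field_simp
  have h1 : 1 + β / α * r ≠ 0 := by rw [h0]; positivity
  have h2 : HasDerivAt (fun r => 1 + β / α * r) (β / α) r := by
    simpa using ((hasDerivAt_id r).const_mul (β / α)).const_add 1
  exact ((h2.log h1).const_mul (1 / β)).congr_deriv (by rw [h0]; field_simp)

lemma ph_D2 {α β r : ℝ} (hα : 0 < α) (hβ : 0 < β) (hr : 0 ≤ r) (c : ℝ) :
    D2 (fun s => ph α β (r + s * c)) (1 / (α + β * r) * c) (-(β * (1 / (α + β * r)) ^ 2 * c ^ 2)) := by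
  have hpos : 0 < α + β * r := by positivity
  have hlin : ∀ s : ℝ, HasDerivAt (fun s => r + s * c) c s := fun s => by
    simpa using ((hasDerivAt_id s).mul_const c).const_add r
  refine ⟨fun s => 1 / (α + β * (r + s * c)) * c, ?_, by simp, ?_⟩
  · have : ∀ᶠ s : ℝ in 𝓝 0, 0 < α + β * (r + s * c) := by
      have : ContinuousAt (fun s : ℝ => α + β * (r + s * c)) 0 := by fun_prop
      exact this.eventually (lt_mem_nhds (by simpa using hpos))
    filter_upwards [this] with s hs
    exact HasDerivAt.comp s (h₂ := ph α β) (h := fun s => r + s * c) (ph_deriv hα hβ hs) (hlin s)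
  · have h1 : HasDerivAt (fun s : ℝ => α + β * (r + s * c)) (β * c) 0 :=
      ((hlin 0).const_mul β).const_add α
    have h2 := (h1.inv (by simpa using hpos.ne')).mul_const c
    have e : (fun s => 1 / (α + β * (r + s * c)) * c)
       = fun s => (fun s : ℝ => α + β * (r + s * c))⁻¹ s * c := by
      funext s; simp
    rw [e]
    refine h2.congr_deriv ?_
    simp
    field_simp

lemma lapl_refl {d : ℕ} {f : EuclideanSpace ℝ (Fin d) → ℝ} (x : EuclideanSpace ℝ (Fin d))
    (R : EuclideanSpace ℝ (Fin d) ≃ₗᵢ[ℝ] EuclideanSpace ℝ (Fin d)) :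
    lapl f x = ∑ i, iteratedFDeriv ℝ 2 f x
      ![R (EuclideanSpace.single i (1:ℝ)), R (EuclideanSpace.single i (1:ℝ))] := by
  have h1 := congrFun (InnerProductSpace.laplacian_eq_iteratedFDeriv_orthonormalBasis f
    (EuclideanSpace.basisFun (Fin d) ℝ)) x
  have h2 := congrFun (InnerProductSpace.laplacian_eq_iteratedFDeriv_orthonormalBasis f
    ((EuclideanSpace.basisFun (Fin d) ℝ).map R)) x
  rw [h1] at h2
  simpa [lapl] using h2

lemma refl_exists {d : ℕ} (n : EuclideanSpace ℝ (Fin d)) (hn : ‖n‖ = 1) :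
    ∃ R : EuclideanSpace ℝ (Fin d) ≃ₗᵢ[ℝ] EuclideanSpace ℝ (Fin d),
      ∀ v, R v = v - (2 * inner ℝ n v) • n := by
  refine ⟨Submodule.reflection (ℝ ∙ n)ᗮ, fun v => ?_⟩
  rw [Submodule.reflection_orthogonal_apply, Submodule.reflection_singleton_apply]
  simp [hn, mul_smul, two_smul]

lemma sum_inner_sq' {d : ℕ} (p : EuclideanSpace ℝ (Fin d)) (hp : ‖p‖ = 1) :
    ∑ i, (inner ℝ p (EuclideanSpace.single i (1:ℝ))) ^ 2 = 1 := by
  rw [sum_inner_sq, hp]; norm_num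

/-- Doubling functional. -/
def Psi {d : ℕ} (h : ℝ → EuclideanSpace ℝ (Fin d) → ℝ) (m ρ α β t : ℝ)
    (x₀ : EuclideanSpace ℝ (Fin d)) (s : ℝ) (x y : EuclideanSpace ℝ (Fin d)) : ℝ :=
  h s y - h s x - m * (ph α β (‖y - x‖ / ρ) + 2 / ρ ^ 2 * (‖x - x₀‖ ^ 2 + ‖y - x₀‖ ^ 2)
    + 2 / ρ ^ 2 * (t - s))

lemma ball_line {d : ℕ} {x x₀ : EuclideanSpace ℝ (Fin d)} {ρ : ℝ} (hx : ‖x - x₀‖ < ρ)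
    (e : EuclideanSpace ℝ (Fin d)) : ∀ᶠ σ : ℝ in 𝓝 0, ‖x + σ • e - x₀‖ ≤ ρ := by
  have : ContinuousAt (fun σ : ℝ => ‖x + σ • e - x₀‖) 0 := by fun_prop
  exact (this.eventually (gt_mem_nhds (by simpa using hx))).mono fun _ h => h.le

lemma IL_grad {d : ℕ} {m ρ α β t s : ℝ} {h : ℝ → EuclideanSpace ℝ (Fin d) → ℝ}
    {x₀ x y : EuclideanSpace ℝ (Fin d)} (hα : 0 < α) (hβ : 0 < β) (hρ : 0 < ρ) (hm : 0 < m)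
    (hr : ContDiff ℝ 2 (h s)) (hy : ‖y - x₀‖ < ρ)
    (hmax : ∀ y', ‖y' - x₀‖ ≤ ρ → Psi h m ρ α β t x₀ s x y' ≤ Psi h m ρ α β t x₀ s x y) :
    ‖gradient (h s) y‖ ≤ m / ρ * (1 / (α + β * (‖y - x‖ / ρ)) + 4) := by
  set r := ‖y - x‖ / ρ with hrdef
  have hr0 : 0 ≤ r := by positivity
  have key : ∀ e : EuclideanSpace ℝ (Fin d), ‖e‖ = 1 → inner ℝ (gradient (h s) y) e ≤
      m / ρ * (1 / (α + β * r) + 4) := by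
    intro e he
    have h1 := (D2_contDiff hr y e).hasDerivAt
    have h2 := (ph_D2 hα hβ hr0 (1 / ρ)).hasDerivAt
    have h3 := (D2_normsq (y - x₀) e).hasDerivAt
    have h4 := h1.sub ((h2.add (h3.const_mul (2 / ρ ^ 2))).const_mul m)
    have h5 := deriv_nonpos_of_right_max h4 ?_
    · have h6 : inner ℝ (y - x₀) e ≤ ρ := by
        refine (real_inner_le_norm _ _).trans ?_
        rw [he, mul_one]; exact hy.le
      have h7 : m * (2 / ρ ^ 2 * (2 * inner ℝ (y - x₀) e)) ≤ m * (2 / ρ ^ 2 * (2 * ρ)) := by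
        gcongr
      have h8 : m * (2 / ρ ^ 2 * (2 * ρ)) = m / ρ * 4 := by field_simp; ring
      have h9 : m * (1 / (α + β * r) * (1 / ρ)) = m / ρ * (1 / (α + β * r)) := by ring
      linarith
    · filter_upwards [nhdsWithin_le_nhds (ball_line hy e), self_mem_nhdsWithin] with σ hσ hσ0
      have hσ0 : 0 < σ := hσ0
      have := hmax _ hσ
      unfold Psi at this
      have h6 : ph α β (‖y + σ • e - x‖ / ρ) ≤ ph α β (r + σ * (1 / ρ)) := by
        refine ph_mono hα hβ (by positivity) ?_
        rw [hrdef, mul_one_div, ← add_div]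
        gcongr
        rw [show y + σ • e - x = (y - x) + σ • e by abel]
        refine (norm_add_le _ _).trans ?_
        rw [norm_smul, he, Real.norm_eq_abs, abs_of_pos hσ0, mul_one]
      have h7 : m * ph α β (‖y + σ • e - x‖ / ρ) ≤ m * ph α β (r + σ * (1 / ρ)) := by gcongr
      rw [show y + σ • e - x₀ = y - x₀ + σ • e by abel] at this
      simp only [Pi.sub_apply, Pi.add_apply, zero_smul, add_zero, zero_mul]
      linarith
  by_cases h0 : gradient (h s) y = 0
  · rw [h0, norm_zero]; positivity
  · have hn : 0 < ‖gradient (h s) y‖ := norm_pos_iff.2 h0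
    have := key (‖gradient (h s) y‖⁻¹ • gradient (h s) y)
      (by rw [norm_smul, norm_inv, norm_norm, inv_mul_cancel₀ hn.ne'])
    rw [inner_smul_right, real_inner_self_eq_norm_sq] at this
    have h2 : ‖gradient (h s) y‖⁻¹ * ‖gradient (h s) y‖ ^ 2 = ‖gradient (h s) y‖ := by
      field_simp
    rwa [h2] at this

lemma IL_lapl {d : ℕ} {m ρ α β t s : ℝ} {h : ℝ → EuclideanSpace ℝ (Fin d) → ℝ}
    {x₀ x y : EuclideanSpace ℝ (Fin d)} (hα : 0 < α) (hβ : 0 < β) (hρ : 0 < ρ)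
    (hr : ContDiff ℝ 2 (h s)) (hx : ‖x - x₀‖ < ρ) (hy : ‖y - x₀‖ < ρ) (hxy : x ≠ y)
    (hmax : ∀ x' y', ‖x' - x₀‖ ≤ ρ → ‖y' - x₀‖ ≤ ρ →
      Psi h m ρ α β t x₀ s x' y' ≤ Psi h m ρ α β t x₀ s x y) :
    lapl (h s) y - lapl (h s) x ≤
      m / ρ ^ 2 * (8 * d - 4 * β * (1 / (α + β * (‖y - x‖ / ρ))) ^ 2) := by
  have hD : 0 < ‖y - x‖ := norm_pos_iff.2 (sub_ne_zero.2 hxy.symm)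
  set r := ‖y - x‖ / ρ with hrdef
  have hr0 : 0 < r := by positivity
  set n := ‖y - x‖⁻¹ • (y - x) with hn
  have hn1 : ‖n‖ = 1 := by rw [hn, norm_smul, norm_inv, norm_norm, inv_mul_cancel₀ hD.ne']
  have hyx : y - x = ‖y - x‖ • n := by rw [hn, smul_smul, mul_inv_cancel₀ hD.ne', one_smul]
  obtain ⟨R, hR⟩ := refl_exists n hn1
  have key : ∀ i : Fin d, iteratedFDeriv ℝ 2 (h s) y
      ![EuclideanSpace.single i (1:ℝ), EuclideanSpace.single i (1:ℝ)] - iteratedFDeriv ℝ 2 (h s) x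
      ![R (EuclideanSpace.single i (1:ℝ)), R (EuclideanSpace.single i (1:ℝ))] ≤
      m / ρ ^ 2 * (8 - 4 * β * (1 / (α + β * r)) ^ 2 *
        (inner ℝ n (EuclideanSpace.single i (1:ℝ))) ^ 2) := by
    intro i
    set e : EuclideanSpace ℝ (Fin d) := EuclideanSpace.single i (1:ℝ) with he
    have he1 : ‖e‖ = 1 := by simp [he]
    have hRe1 : ‖R e‖ = 1 := by rw [R.norm_map, he1]
    set c := inner ℝ n e with hc
    have h4 := ((D2_contDiff hr y e).sub (D2_contDiff hr x (R e))).sub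
      (((ph_D2 hα hβ hr0.le (2 * c / ρ)).add
      (((D2_normsq (x - x₀) (R e)).add (D2_normsq (y - x₀) e)).const_mul (2 / ρ ^ 2))).const_mul m)
    have h5 := (h4.of_le ?_).2
    · rw [he1, hRe1] at h5
      have e1 : m * (-(β * (1 / (α + β * r)) ^ 2 * (2 * c / ρ) ^ 2) +
        2 / ρ ^ 2 * (2 * 1 ^ 2 + 2 * 1 ^ 2)) = m / ρ ^ 2 * (8 - 4 * β * (1 / (α + β * r)) ^ 2 * c ^ 2) := by
        field_simp; ring
      rw [e1] at h5
      linarith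
    · have hpos : ∀ᶠ σ : ℝ in 𝓝 0, 0 < ‖y - x‖ + σ * (2 * c) := by
        have : ContinuousAt (fun σ : ℝ => ‖y - x‖ + σ * (2 * c)) 0 := by fun_prop
        exact this.eventually (lt_mem_nhds (by simpa using hD))
      filter_upwards [ball_line hx (R e), ball_line hy e, hpos] with σ h1 h2 h3
      have := hmax _ _ h1 h2
      unfold Psi at this
      have e1 : ‖y + σ • e - (x + σ • R e)‖ / ρ = r + σ * (2 * c / ρ) := by
        rw [hR e]
        have : y + σ • e - (x + σ • (e - (2 * inner ℝ n e) • n))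
          = (‖y - x‖ + σ * (2 * c)) • n := by
          rw [add_smul, ← hyx, smul_sub, smul_smul]; abel
        rw [this, norm_smul, hn1, Real.norm_eq_abs, abs_of_pos h3, hrdef]
        field_simp
      rw [e1, show y + σ • e - x₀ = y - x₀ + σ • e by abel,
        show x + σ • R e - x₀ = x - x₀ + σ • R e by abel, ← hrdef] at this
      simp only [zero_smul, add_zero, zero_mul]
      linarith
  have hsum := Finset.sum_le_sum fun i (_ : i ∈ Finset.univ) => key i
  rw [lapl_refl x R, lapl, ← Finset.sum_sub_distrib]
  refine hsum.trans (le_of_eq ?_)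
  rw [← Finset.mul_sum, Finset.sum_sub_distrib, ← Finset.mul_sum, sum_inner_sq' n hn1]
  simp
  left; ring

lemma IL_core {d : ℕ} {ν lam T m ρ α β κ t s : ℝ} {V : EuclideanSpace ℝ (Fin d) → ℝ} {W : ℝ → ℝ}
    {h₀ : EuclideanSpace ℝ (Fin d) → ℝ} {h : ℝ → EuclideanSpace ℝ (Fin d) → ℝ}
    (hν : 0 < ν) (hlam : 0 < lam) (hV : IsDepositionRate d V W)
    (hs : IsClassicalSolution ν lam T V h₀ h)
    {x₀ x y : EuclideanSpace ℝ (Fin d)} (hα : 0 < α) (hβ : 0 < β) (hρ : 0 < ρ) (hm : 0 < m)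
    (hκ : lam * m ≤ κ) (hβκ : 4 * ν * β = 4 * κ + 3 + 8 * d * ν)
    (ht : s ∈ Ioc 0 T) {a : ℝ} (ha : a < s)
    (hx : ‖x - x₀‖ < ρ) (hy : ‖y - x₀‖ < ρ) (hxy : x ≠ y)
    (hψ : 4 ≤ 1 / (α + β * (‖y - x‖ / ρ)))
    (hmaxt : ∀ s' ∈ Ico a s, Psi h m ρ α β t x₀ s' x y ≤ Psi h m ρ α β t x₀ s x y)
    (hmax : ∀ x' y', ‖x' - x₀‖ ≤ ρ → ‖y' - x₀‖ ≤ ρ →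
      Psi h m ρ α β t x₀ s x' y' ≤ Psi h m ρ α β t x₀ s x y) : False := by
  have hr := hs.space_reg s ht
  have h1 := IL_grad hα hβ hρ hm hr hy (fun y' hy' => hmax x y' hx.le hy')
  have h2 := IL_lapl hα hβ hρ hr hx hy hxy hmax
  set ψ := 1 / (α + β * (‖y - x‖ / ρ)) with hψd
  have hlin : HasDerivAt (fun s' : ℝ => ph α β (‖y - x‖ / ρ) +
      2 / ρ ^ 2 * (‖x - x₀‖ ^ 2 + ‖y - x₀‖ ^ 2) + 2 / ρ ^ 2 * (t - s')) (2 / ρ ^ 2 * (-1)) s :=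
    (((hasDerivAt_id s).const_sub t).const_mul (2 / ρ ^ 2)).const_add _
  have h3 := deriv_nonneg_of_left_max (((sol_hasDeriv hs ht y).sub (sol_hasDeriv hs ht x)).sub
    (hlin.const_mul m)) ha hmaxt
  have h4 := (V_bounds hV (gradient (h s) y)).2
  have h5 := (V_bounds hV (gradient (h s) x)).1
  have h6 : lam * V (gradient (h s) y) ≤ lam * (m / ρ * (ψ + 4)) ^ 2 := by
    gcongr; exact h4.trans (by gcongr)
  have h7 : 0 ≤ lam * V (gradient (h s) x) := by positivity
  have h8 := mul_le_mul_of_nonneg_left h2 hν.le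
  have h9 : 0 ≤ m / ρ ^ 2 * (2 + ν * (8 * d - 4 * β * ψ ^ 2) + lam * m * (ψ + 4) ^ 2) := by
    have e : m / ρ ^ 2 * (2 + ν * (8 * d - 4 * β * ψ ^ 2) + lam * m * (ψ + 4) ^ 2)
      = - (m * (2 / ρ ^ 2 * (-1))) + ν * (m / ρ ^ 2 * (8 * d - 4 * β * ψ ^ 2))
        + lam * (m / ρ * (ψ + 4)) ^ 2 := by field_simp
    rw [e]
    linarith
  have h10 : 0 < m / ρ ^ 2 := by positivity
  have h11 : 0 ≤ 2 + ν * (8 * d - 4 * β * ψ ^ 2) + lam * m * (ψ + 4) ^ 2 :=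
    nonneg_of_mul_nonneg_right h9 h10
  have h12 : lam * m * (ψ + 4) ^ 2 ≤ κ * (4 * ψ ^ 2) := by
    have : (ψ + 4) ^ 2 ≤ 4 * ψ ^ 2 := by nlinarith
    have : 0 ≤ lam * m := by positivity
    gcongr
    linarith
  have h13 : ν * (8 * d - 4 * β * ψ ^ 2) = 8 * d * ν - (4 * κ + 3 + 8 * d * ν) * ψ ^ 2 := by
    rw [← hβκ]; ring
  have h14 : 1 ≤ ψ ^ 2 := by nlinarith
  have h15 : (3 + 8 * d * ν) * 1 ≤ (3 + 8 * d * ν) * ψ ^ 2 := by gcongr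
  linarith

lemma IL {d : ℕ} {ν lam T m ρ κ t : ℝ} {V : EuclideanSpace ℝ (Fin d) → ℝ} {W : ℝ → ℝ}
    {h₀ : EuclideanSpace ℝ (Fin d) → ℝ} {h : ℝ → EuclideanSpace ℝ (Fin d) → ℝ}
    (hν : 0 < ν) (hlam : 0 < lam) (hV : IsDepositionRate d V W)
    (hs : IsClassicalSolution ν lam T V h₀ h)
    (x₀ : EuclideanSpace ℝ (Fin d)) (hρ : 0 < ρ) (hm : 0 < m)
    (hκ : lam * m ≤ κ) (htρ : 0 ≤ t - ρ ^ 2) (htT : t ≤ T)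
    (hb : ∀ s ∈ Icc (t - ρ ^ 2) t, ∀ x, ‖x - x₀‖ ≤ ρ → |h s x| ≤ m) :
    ‖gradient (h t) x₀‖ ≤ 8 * Real.exp (2 * ((4 * κ + 3 + 8 * d * ν) / (4 * ν))) * (m / ρ) := by
  have hκ0 : 0 < κ := lt_of_lt_of_le (by positivity) hκ
  set β := (4 * κ + 3 + 8 * d * ν) / (4 * ν) with hβd
  have hβ : 0 < β := by positivity
  set α := (1/8) * Real.exp (-(2 * β)) with hαd
  have hα : 0 < α := by positivity
  have hα8 : 1 / α = 8 * Real.exp (2 * β) := by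
    rw [hαd, Real.exp_neg]; field_simp
  have hα1 : α ≤ 1/8 := by
    have : Real.exp (-(2 * β)) ≤ 1 := by rw [Real.exp_le_one_iff]; linarith
    rw [hαd]; linarith
  have hphr0 : 2 ≤ ph α β (1 / (8 * β)) := by
    unfold ph
    have e1 : β / α * (1 / (8 * β)) = Real.exp (2 * β) := by
      have : β / α * (1 / (8 * β)) = (1 / α) / 8 := by field_simp
      rw [this, hα8]; ring
    rw [e1]
    have : 2 * β ≤ Real.log (1 + Real.exp (2 * β)) := by
      rw [Real.le_log_iff_exp_le (by positivity)]; linarith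
    calc (2:ℝ) = (1 / β) * (2 * β) := by field_simp
      _ ≤ _ := by gcongr
  have ht0 : 0 < t := by have : 0 < ρ ^ 2 := by positivity
                         linarith
  have hPsi : ∀ s ∈ Icc (t - ρ ^ 2) t, ∀ x y, ‖x - x₀‖ ≤ ρ → ‖y - x₀‖ ≤ ρ →
      Psi h m ρ α β t x₀ s x y ≤ 0 := by
    set K : Set (ℝ × EuclideanSpace ℝ (Fin d) × EuclideanSpace ℝ (Fin d)) :=
      Icc (t - ρ ^ 2) t ×ˢ (Metric.closedBall x₀ ρ ×ˢ Metric.closedBall x₀ ρ) with hK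
    have hKc : IsCompact K := isCompact_Icc.prod
      ((isCompact_closedBall x₀ ρ).prod (isCompact_closedBall x₀ ρ))
    have hKn : K.Nonempty := ⟨(t, x₀, x₀), ⟨⟨by linarith [sq_nonneg ρ], le_rfl⟩,
      by simp [hρ.le], by simp [hρ.le]⟩⟩
    have hc1 : ContinuousOn (fun p : ℝ × EuclideanSpace ℝ (Fin d) × EuclideanSpace ℝ (Fin d) =>
        h p.1 p.2.1) K := by
      refine hs.cont.comp (f := fun p : ℝ × EuclideanSpace ℝ (Fin d) × EuclideanSpace ℝ (Fin d) =>
        (p.1, p.2.1)) (by fun_prop) ?_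
      rintro ⟨s, x, y⟩ ⟨h1, -⟩
      exact ⟨⟨htρ.trans h1.1, h1.2.trans htT⟩, mem_univ _⟩
    have hc2 : ContinuousOn (fun p : ℝ × EuclideanSpace ℝ (Fin d) × EuclideanSpace ℝ (Fin d) =>
        h p.1 p.2.2) K := by
      refine hs.cont.comp (f := fun p : ℝ × EuclideanSpace ℝ (Fin d) × EuclideanSpace ℝ (Fin d) =>
        (p.1, p.2.2)) (by fun_prop) ?_
      rintro ⟨s, x, y⟩ ⟨h1, -⟩
      exact ⟨⟨htρ.trans h1.1, h1.2.trans htT⟩, mem_univ _⟩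
    have hc3 : Continuous (fun p : ℝ × EuclideanSpace ℝ (Fin d) × EuclideanSpace ℝ (Fin d) =>
        ph α β (‖p.2.2 - p.2.1‖ / ρ)) := by
      unfold ph
      refine continuous_const.mul (Continuous.log (by fun_prop) fun p => ?_)
      positivity
    have hc : ContinuousOn (fun p : ℝ × EuclideanSpace ℝ (Fin d) × EuclideanSpace ℝ (Fin d) =>
        Psi h m ρ α β t x₀ p.1 p.2.1 p.2.2) K := by
      unfold Psi
      refine (hc2.sub hc1).sub (continuousOn_const.mul ((hc3.continuousOn.add ?_).add ?_)) <;>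
      fun_prop
    obtain ⟨⟨s, x, y⟩, ⟨hsK, hxK, hyK⟩, hmx⟩ := hKc.exists_isMaxOn hKn hc
    simp only [Metric.mem_closedBall, dist_eq_norm] at hxK hyK
    simp only at hsK
    have hmx' : ∀ s' ∈ Icc (t - ρ ^ 2) t, ∀ x' y', ‖x' - x₀‖ ≤ ρ → ‖y' - x₀‖ ≤ ρ →
        Psi h m ρ α β t x₀ s' x' y' ≤ Psi h m ρ α β t x₀ s x y := by
      intro s' hs' x' y' hx' hy'
      exact hmx (show (s', x', y') ∈ K from ⟨hs', by simpa [dist_eq_norm] using hx',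
        by simpa [dist_eq_norm] using hy'⟩)
    suffices hle : Psi h m ρ α β t x₀ s x y ≤ 0 from
      fun s' hs' x' y' hx' hy' => (hmx' s' hs' x' y' hx' hy').trans hle
    by_contra! hpos
    have hp0 : 0 ≤ ph α β (‖y - x‖ / ρ) := ph_nonneg hα hβ (by positivity)
    have hA : ph α β (‖y - x‖ / ρ) + 2 / ρ ^ 2 * (‖x - x₀‖ ^ 2 + ‖y - x₀‖ ^ 2)
        + 2 / ρ ^ 2 * (t - s) < 2 := by
      have h1 := abs_le.1 (hb s hsK x hxK)
      have h2 := abs_le.1 (hb s hsK y hyK)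
      unfold Psi at hpos
      refine lt_of_mul_lt_mul_left (a := m) ?_ hm.le
      linarith [h1.1, h2.2]
    have hts : 0 ≤ 2 / ρ ^ 2 * (t - s) := mul_nonneg (by positivity) (by linarith [hsK.2])
    have hX : 0 ≤ 2 / ρ ^ 2 * ‖x - x₀‖ ^ 2 := by positivity
    have hY : 0 ≤ 2 / ρ ^ 2 * ‖y - x₀‖ ^ 2 := by positivity
    rw [mul_add] at hA
    have hcan : ∀ q : ℝ, 2 / ρ ^ 2 * q < 2 → q < ρ ^ 2 := by
      intro q hq
      rw [div_mul_eq_mul_div, div_lt_iff₀ (by positivity)] at hq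
      linarith
    have hs1 : t - ρ ^ 2 < s := by
      have := hcan (t - s) (by linarith)
      linarith
    have hx1 : ‖x - x₀‖ < ρ := lt_of_pow_lt_pow_left₀ 2 hρ.le (hcan _ (by linarith))
    have hy1 : ‖y - x₀‖ < ρ := lt_of_pow_lt_pow_left₀ 2 hρ.le (hcan _ (by linarith))
    have hr1 : ‖y - x‖ / ρ < 1 / (8 * β) := by
      by_contra! hcon
      have := ph_mono hα hβ (by positivity) hcon
      linarith
    have hxy : x ≠ y := by
      rintro rfl
      unfold Psi at hpos
      have : 0 ≤ m * (ph α β (‖x - x‖ / ρ) + 2 / ρ ^ 2 * (‖x - x₀‖ ^ 2 + ‖x - x₀‖ ^ 2)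
        + 2 / ρ ^ 2 * (t - s)) := by
        apply mul_nonneg hm.le
        linarith
      linarith
    have hψ : 4 ≤ 1 / (α + β * (‖y - x‖ / ρ)) := by
      have h1 : β * (‖y - x‖ / ρ) ≤ β * (1 / (8 * β)) := by gcongr
      have h2 : β * (1 / (8 * β)) = 1 / 8 := by field_simp
      rw [le_div_iff₀ (by positivity)]
      linarith
    exact IL_core hν hlam hV hs hα hβ hρ hm hκ (by rw [hβd]; field_simp)
      ⟨lt_of_le_of_lt htρ hs1, hsK.2.trans htT⟩ hs1 hx1 hy1 hxy hψ
      (fun s' hs' => hmx' s' ⟨hs'.1, hs'.2.le.trans hsK.2⟩ x y hxK hyK)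
      (fun x' y' hx' hy' => hmx' s hsK x' y' hx' hy')
  have hr := hs.space_reg t ⟨ht0, htT⟩
  have key : ∀ e : EuclideanSpace ℝ (Fin d), ‖e‖ = 1 → inner ℝ (gradient (h t) x₀) e ≤
      8 * Real.exp (2 * β) * (m / ρ) := by
    intro e he
    have h1 := (D2_contDiff hr x₀ e).hasDerivAt
    have h2 : HasDerivAt (fun σ : ℝ => m * (σ * (1 / α / ρ) + 2 / ρ ^ 2 * σ ^ 2))
        (m * (1 / α / ρ)) 0 := by
      have a1 := (hasDerivAt_id (0:ℝ)).mul_const (1 / α / ρ)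
      have a2 := ((hasDerivAt_id (0:ℝ)).pow 2).const_mul (2 / ρ ^ 2)
      exact ((a1.add a2).const_mul m).congr_deriv (by simp)
    have h5 := deriv_nonpos_of_right_max (h1.sub h2) ?_
    · have : m * (1 / α / ρ) = 1 / α * (m / ρ) := by ring
      rw [this, hα8] at h5
      linarith
    · filter_upwards [Ioo_mem_nhdsGT hρ] with σ hσ
      have hσ0 := hσ.1
      have e1 : ‖x₀ + σ • e - x₀‖ = σ := by
        rw [add_sub_cancel_left, norm_smul, he, Real.norm_eq_abs, abs_of_pos hσ0, mul_one]
      have h6 := hPsi t ⟨by linarith [sq_nonneg ρ], le_rfl⟩ x₀ (x₀ + σ • e)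
        (by simpa using hρ.le) (by rw [e1]; exact hσ.2.le)
      unfold Psi at h6
      rw [e1] at h6
      have h7 := ph_le hα hβ (by positivity : 0 ≤ σ / ρ)
      have h8 : m * ph α β (σ / ρ) ≤ m * (σ / ρ / α) := by gcongr
      have h9 : σ / ρ / α = σ * (1 / α / ρ) := by field_simp
      rw [h9] at h8
      simp only [Pi.sub_apply, zero_smul, add_zero, zero_mul, sub_self, norm_zero] at h6 ⊢
      norm_num at h6 h8 ⊢
      linarith
  by_cases h0 : gradient (h t) x₀ = 0
  · rw [h0, norm_zero]; positivity
  · have hn : 0 < ‖gradient (h t) x₀‖ := norm_pos_iff.2 h0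
    have := key (‖gradient (h t) x₀‖⁻¹ • gradient (h t) x₀)
      (by rw [norm_smul, norm_inv, norm_norm, inv_mul_cancel₀ hn.ne'])
    rw [inner_smul_right, real_inner_self_eq_norm_sq] at this
    have h2 : ‖gradient (h t) x₀‖⁻¹ * ‖gradient (h t) x₀‖ ^ 2 = ‖gradient (h t) x₀‖ := by
      field_simp
    rwa [h2] at this

lemma gk_compare {d : ℕ} {ν t s : ℝ} (hν : 0 < ν) (ht : 0 < t) (hs : t / 2 ≤ s) (hst : s ≤ t)
    {x y : EuclideanSpace ℝ (Fin d)} (hxy : ‖y - x‖ ^ 2 ≤ t / 2) (ξ : EuclideanSpace ℝ (Fin d)) :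
    gk (4 * ν * s) (y - ξ) ≤
      (4:ℝ) ^ ((d:ℝ)/2) * Real.exp (1 / (8 * ν)) * gk (8 * ν * t) (x - ξ) := by
  have hs0 : 0 < s := by linarith
  unfold gk
  have h1 : (π * (4 * ν * s)) ^ (-(d:ℝ)/2) ≤ (4:ℝ) ^ ((d:ℝ)/2) * (π * (8 * ν * t)) ^ (-(d:ℝ)/2) := by
    have e1 : π * (8 * ν * t) = 4 * (π * (2 * ν * t)) := by ring
    rw [e1, Real.mul_rpow (x := 4) (y := π * (2 * ν * t)) (by norm_num) (by positivity),
      ← mul_assoc ((4:ℝ) ^ ((d:ℝ)/2)),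
      ← Real.rpow_add (by norm_num), show (d:ℝ)/2 + -(d:ℝ)/2 = 0 by ring, Real.rpow_zero, one_mul]
    refine Real.rpow_le_rpow_of_nonpos (by positivity) ?_ ?_
    · have : ν * (t / 2) ≤ ν * s := by gcongr
      gcongr π * ?_
      linarith
    · have : (0:ℝ) ≤ d := by positivity
      linarith
  have h2 : Real.exp (-‖y - ξ‖ ^ 2 / (4 * ν * s)) ≤
      Real.exp (1 / (8 * ν)) * Real.exp (-‖x - ξ‖ ^ 2 / (8 * ν * t)) := by
    rw [← Real.exp_add]
    refine Real.exp_le_exp.2 ?_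
    have h3 : ‖x - ξ‖ ≤ ‖y - ξ‖ + ‖y - x‖ := by
      rw [show x - ξ = (y - ξ) - (y - x) by abel]; exact norm_sub_le _ _
    have h4 : ‖x - ξ‖ ^ 2 ≤ 2 * ‖y - ξ‖ ^ 2 + 2 * ‖y - x‖ ^ 2 := by
      have : ‖x - ξ‖ ^ 2 ≤ (‖y - ξ‖ + ‖y - x‖) ^ 2 := by gcongr
      nlinarith [sq_nonneg (‖y - ξ‖ - ‖y - x‖)]
    have h5 : ‖y - ξ‖ ^ 2 / (4 * ν * t) ≤ ‖y - ξ‖ ^ 2 / (4 * ν * s) := by gcongr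
    have h6 : ‖x - ξ‖ ^ 2 / (8 * ν * t) ≤ (2 * ‖y - ξ‖ ^ 2 + t) / (8 * ν * t) := by
      gcongr; linarith
    have h7 : (2 * ‖y - ξ‖ ^ 2 + t) / (8 * ν * t) = ‖y - ξ‖ ^ 2 / (4 * ν * t) + 1 / (8 * ν) := by
      field_simp; ring
    rw [neg_div, neg_div]
    linarith
  calc (π * (4 * ν * s)) ^ (-(d:ℝ)/2) * Real.exp (-‖y - ξ‖ ^ 2 / (4 * ν * s))
      ≤ ((4:ℝ) ^ ((d:ℝ)/2) * (π * (8 * ν * t)) ^ (-(d:ℝ)/2)) *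
        (Real.exp (1 / (8 * ν)) * Real.exp (-‖x - ξ‖ ^ 2 / (8 * ν * t))) := by gcongr
    _ = _ := by ring

lemma HU_compare {d : ℕ} {ν t s : ℝ} (hν : 0 < ν) (ht : 0 < t) (hs : t / 2 ≤ s) (hst : s ≤ t)
    {x y : EuclideanSpace ℝ (Fin d)} (hxy : ‖y - x‖ ^ 2 ≤ t / 2)
    {g : EuclideanSpace ℝ (Fin d) → ℝ} (hg : Integrable g) (hg0 : ∀ x, 0 ≤ g x) :
    HU g (4 * ν * s) y ≤
      (4:ℝ) ^ ((d:ℝ)/2) * Real.exp (1 / (8 * ν)) * HU g (8 * ν * t) x := by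
  have hs0 : 0 < s := by linarith
  unfold HU
  rw [← integral_const_mul]
  refine integral_mono (gk_mul_integrable hg (by positivity) y)
    ((gk_mul_integrable hg (by positivity) x).const_mul _) fun ξ => ?_
  have := mul_le_mul_of_nonneg_right (gk_compare hν ht hs hst hxy ξ) (hg0 ξ)
  simp only
  linarith

lemma sol_grad_late {d : ℕ} {ν lam T L M : ℝ} {V : EuclideanSpace ℝ (Fin d) → ℝ} {W : ℝ → ℝ}
    {h₀ : EuclideanSpace ℝ (Fin d) → ℝ} {h : ℝ → EuclideanSpace ℝ (Fin d) → ℝ}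
    (hν : 0 < ν) (hlam : 0 < lam) (hV : IsDepositionRate d V W)
    (hs : IsClassicalSolution ν lam T V h₀ h) (hL0 : 0 ≤ L)
    (hL : ∀ x y, |h₀ x - h₀ y| ≤ L * ‖x - y‖) (hi : Integrable h₀)
    (hM : ∀ x, |h₀ x| ≤ M) (hM0 : 0 < M) {t : ℝ} (ht : t ∈ Ioc (0:ℝ) T) :
    ∫⁻ x, ENNReal.ofReal ‖gradient (h t) x‖ ≤ ENNReal.ofReal
      (8 * Real.exp ((3 + 8 * d * ν) / (2 * ν)) * (4:ℝ) ^ ((d:ℝ)/2) * Real.exp (1 / (8 * ν))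
        * Real.exp (3 / ν * (lam * M)) * (∫ x, |h₀ x|) / √(t / 2)) := by
  have ht0 := ht.1
  set ρ := √(t / 2) with hρd
  have hρ : 0 < ρ := by positivity
  have hρ2 : ρ ^ 2 = t / 2 := Real.sq_sqrt (by positivity)
  set g : EuclideanSpace ℝ (Fin d) → ℝ := fun y => |h₀ y| with hg
  have hg0 : ∀ x, 0 ≤ g x := fun x => abs_nonneg _
  have ht8 : 0 < 8 * ν * t := by positivity
  set Kc := (4:ℝ) ^ ((d:ℝ)/2) * Real.exp (1 / (8 * ν)) with hKc
  have hKcpos : 0 < Kc := by positivity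
  obtain ⟨A1, A2⟩ := sol_abs hν hlam hV hs hM hL0 hL hi
  set E := Real.exp (2 * ((4 * (lam * M) + 3 + 8 * d * ν) / (4 * ν))) with hE
  set A := 8 * E * (Real.exp (lam / ν * M) * Kc) / ρ with hA
  have hApos : 0 < A := by positivity
  have hpt : ∀ x, ‖gradient (h t) x‖ ≤ A * HU g (8 * ν * t) x := by
    intro x
    have hU0 := HU_nonneg hg0 ht8 x
    set Q := Real.exp (lam / ν * M) * Kc * HU g (8 * ν * t) x with hQ
    have hQ0 : 0 ≤ Q := by positivity
    have key : ∀ ε : ℝ, 0 < ε → ‖gradient (h t) x‖ ≤ 8 * E * ((Q + ε) / ρ) := by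
      intro ε hε
      have := IL hν hlam hV hs x hρ (m := min M (Q + ε)) (κ := lam * M) (t := t)
        (lt_min hM0 (by linarith)) (by gcongr; exact min_le_left _ _)
        (by rw [hρ2]; linarith) ht.2 ?_
      · refine this.trans ?_
        gcongr
        exact min_le_right _ _
      · intro s hs' y hy
        rw [hρ2] at hs'
        have hs1 : t / 2 ≤ s := by linarith [hs'.1]
        refine le_min (A1 s ⟨by linarith, hs'.2.trans ht.2⟩ y) ?_
        have h1 := A2 s ⟨by linarith, hs'.2.trans ht.2⟩ y
        have h2 := HU_compare hν ht0 hs1 hs'.2 (x := x) (y := y)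
          (by rw [← hρ2]; gcongr) hi.abs hg0
        have h3 : Real.exp (lam / ν * M) * HU g (4 * ν * s) y ≤
          Real.exp (lam / ν * M) * (Kc * HU g (8 * ν * t) x) := by gcongr
        linarith
    have hlim : Tendsto (fun ε : ℝ => 8 * E * ((Q + ε) / ρ)) (𝓝[>] 0) (𝓝 (8 * E * ((Q + 0) / ρ))) := by
      refine Tendsto.mono_left ?_ nhdsWithin_le_nhds
      exact ContinuousAt.tendsto (f := fun ε : ℝ => 8 * E * ((Q + ε) / ρ)) (by fun_prop)
    have hfin := ge_of_tendsto hlim (by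
      filter_upwards [self_mem_nhdsWithin] with ε hε using key ε hε)
    refine hfin.trans (le_of_eq ?_)
    rw [hA, hQ, add_zero]; ring
  calc ∫⁻ x, ENNReal.ofReal ‖gradient (h t) x‖
      ≤ ∫⁻ x, ENNReal.ofReal A * ENNReal.ofReal (HU g (8 * ν * t) x) := by
        refine lintegral_mono fun x => ?_
        rw [← ENNReal.ofReal_mul (by positivity)]
        exact ENNReal.ofReal_le_ofReal (hpt x)
    _ = ENNReal.ofReal A * ∫⁻ x, ENNReal.ofReal (HU g (8 * ν * t) x) :=
        lintegral_const_mul' _ _ ENNReal.ofReal_ne_top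
    _ ≤ ENNReal.ofReal A * ENNReal.ofReal (∫ x, g x) := by
        gcongr; exact HU_lintegral hi.abs hg0 ht8
    _ = _ := by
        rw [← ENNReal.ofReal_mul (by positivity)]
        congr 1
        have e1 : E * Real.exp (lam / ν * M)
            = Real.exp ((3 + 8 * d * ν) / (2 * ν)) * Real.exp (3 / ν * (lam * M)) := by
          rw [hE, ← Real.exp_add, ← Real.exp_add]
          congr 1; field_simp; ring
        have e2 : A * ∫ x, g x = 8 * (E * Real.exp (lam / ν * M)) * Kc * (∫ x, g x) / ρ := by
          rw [hA]; ring
        rw [e2, e1, hKc]; ring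

lemma lip_of_grad {d : ℕ} {h₀ : EuclideanSpace ℝ (Fin d) → ℝ} {L : ℝ} (hd : Differentiable ℝ h₀)
    (hL : ∀ x, ‖gradient h₀ x‖ ≤ L) (x y : EuclideanSpace ℝ (Fin d)) :
    |h₀ x - h₀ y| ≤ L * ‖x - y‖ := by
  have := convex_univ.norm_image_sub_le_of_norm_fderiv_le (𝕜 := ℝ) (f := h₀) (C := L)
    (fun z _ => hd z) (fun z _ => by
      have := hL z
      rwa [gradient, LinearIsometryEquiv.norm_map] at this) (mem_univ y) (mem_univ x)
  simpa using this

/-- Decay in `L¹`-norm of the gradient: under the strengthened assumption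
`y W'(y) - W(y) ≥ C₀ y²`, there are constants `C, c > 0` depending only on `d`, `ν`, `C₀`
such that, with
`J = max(1, ‖∇h₀‖₁/‖h₀‖₁, λ‖∇h₀‖_∞ (1 + cλ‖h₀‖_∞)) ‖h₀‖₁ e^{cλ‖h₀‖_∞}`, one has
`‖∇h(t,·)‖₁ ≤ C max(J, J^{1+1/d}) (1+t)^{-1/2}` for every `t ∈ [0,T]`. -/
theorem statement6 {d : ℕ} (hd : 1 ≤ d) (ν C₀ : ℝ) (hν : 0 < ν) (hC₀ : 0 < C₀) :
    ∃ C > (0:ℝ), ∃ c > (0:ℝ),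
      ∀ (V : EuclideanSpace ℝ (Fin d) → ℝ) (W : ℝ → ℝ), IsDepositionRate d V W →
      (∀ y : ℝ, 0 ≤ y → C₀ * y ^ 2 ≤ y * deriv W y - W y) →
      ∀ (lam T : ℝ), 0 < lam → 0 < T →
      ∀ (h₀ : EuclideanSpace ℝ (Fin d) → ℝ) (h : ℝ → EuclideanSpace ℝ (Fin d) → ℝ),
        MemW1inf h₀ → IsClassicalSolution ν lam T V h₀ h →
        Integrable h₀ (volume : Measure (EuclideanSpace ℝ (Fin d))) →
        Integrable (fun x => gradient h₀ x) (volume : Measure (EuclideanSpace ℝ (Fin d))) →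
        0 < ∫ x, |h₀ x| →
        ∀ t ∈ Set.Icc (0:ℝ) T,
          (∫⁻ x, ENNReal.ofReal ‖gradient (h t) x‖) ≤
            ENNReal.ofReal (C *
              (let J : ℝ :=
                max (max 1 ((∫ x, ‖gradient h₀ x‖) / ∫ x, |h₀ x|))
                    (lam * (⨆ x, ‖gradient h₀ x‖) * (1 + c * (lam * ⨆ x, |h₀ x|))) *
                (∫ x, |h₀ x|) * Real.exp (c * (lam * ⨆ x, |h₀ x|));
              max J (J ^ ((1:ℝ) + 1/(d:ℝ))) * (1 + t) ^ (-(1:ℝ)/2))) := by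
  set A : ℝ := 8 * Real.exp ((3 + 8 * d * ν) / (2 * ν)) * (4:ℝ) ^ ((d:ℝ)/2)
    * Real.exp (1 / (8 * ν)) with hA
  have hApos : 0 < A := by positivity
  refine ⟨2 * A + 12 * Real.exp (1 / ν), by positivity, 3 / ν, by positivity, ?_⟩
  intro V W hV _ lam T hlam hT h₀ h hW hs hi hgi hI t ht
  set M : ℝ := ⨆ x, |h₀ x| with hMd
  set L : ℝ := ⨆ x, ‖gradient h₀ x‖ with hLd
  set I : ℝ := ∫ x, |h₀ x| with hId
  set G : ℝ := ∫ x, ‖gradient h₀ x‖ with hGd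
  have hM : ∀ x, |h₀ x| ≤ M := by
    obtain ⟨C, hC⟩ := hW.bdd
    exact fun x => le_ciSup (f := fun x => |h₀ x|) ⟨C, by rintro _ ⟨y, rfl⟩; exact hC y⟩ x
  have hLg : ∀ x, ‖gradient h₀ x‖ ≤ L := by
    obtain ⟨C, hC⟩ := hW.grad_bdd
    exact fun x => le_ciSup (f := fun x => ‖gradient h₀ x‖) ⟨C, by rintro _ ⟨y, rfl⟩; exact hC y⟩ x
  have hL0 : 0 ≤ L := (norm_nonneg _).trans (hLg 0)
  have hL := lip_of_grad hW.diff hLg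
  have hM0 : 0 < M := by
    by_contra! hcon
    have : (fun x => |h₀ x|) = fun _ => 0 := by
      funext x; exact le_antisymm ((hM x).trans hcon) (abs_nonneg _)
    rw [hId, this] at hI
    simp at hI
  have hG0 : 0 ≤ G := integral_nonneg fun x => norm_nonneg _
  set X : ℝ := max (max 1 (G / I)) (lam * L * (1 + 3 / ν * (lam * M))) with hX
  set Ex : ℝ := Real.exp (3 / ν * (lam * M)) with hEx
  have hEx1 : 1 ≤ Ex := Real.one_le_exp (by positivity)
  have hX1 : 1 ≤ X := (le_max_left _ _).trans (le_max_left _ _)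
  have hX2 : G ≤ X * I := by
    have : G / I ≤ X := (le_max_right _ _).trans (le_max_left _ _)
    rwa [div_le_iff₀ hI] at this
  have hX3 : lam * L ≤ X := by
    refine le_trans ?_ (le_max_right _ _)
    have h1 : 0 ≤ 3 / ν * (lam * M) := by positivity
    have h2 : 0 ≤ lam * L := by positivity
    nlinarith
  have hXI : X * I ≤ X * I * Ex := le_mul_of_one_le_right (by positivity) hEx1
  have hJ0 : 0 < X * I * Ex := by positivity
  have hD : 0 < (1 + t) ^ (-(1:ℝ)/2) := by have := ht.1; positivity
  suffices hmain : (∫⁻ x, ENNReal.ofReal ‖gradient (h t) x‖) ≤ ENNReal.ofReal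
      ((2 * A + 12 * Real.exp (1 / ν)) * (X * I * Ex * (1 + t) ^ (-(1:ℝ)/2))) by
    refine hmain.trans (ENNReal.ofReal_le_ofReal ?_)
    simp only
    gcongr
    exact le_max_left _ _
  have hsq : (1 + t) ^ (-(1:ℝ)/2) = 1 / √(1 + t) := by
    rw [Real.sqrt_eq_rpow, neg_div, Real.rpow_neg (by linarith [ht.1]), ← one_div]
  have hsqpos : 0 < √(1 + t) := Real.sqrt_pos.2 (by linarith [ht.1])
  by_cases ht1 : t ≤ 1
  · have hhalf : 1 / 2 ≤ (1 + t) ^ (-(1:ℝ)/2) := by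
      rw [hsq]
      refine one_div_le_one_div_of_le hsqpos ?_
      rw [Real.sqrt_le_left (by norm_num)]
      linarith
    have hbig : 6 * Real.exp (1 / ν) * (X * I * Ex) ≤
        (2 * A + 12 * Real.exp (1 / ν)) * (X * I * Ex * (1 + t) ^ (-(1:ℝ)/2)) := by
      calc 6 * Real.exp (1 / ν) * (X * I * Ex)
          = (12 * Real.exp (1 / ν)) * (X * I * Ex * (1 / 2)) := by ring
        _ ≤ _ := by
          gcongr
          linarith
    have he1 : 1 ≤ Real.exp (1 / ν) := Real.one_le_exp (by positivity)
    rcases ht.1.eq_or_lt with h0 | h0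
    · rw [← h0, sol_zero hs, ← ofReal_integral_eq_lintegral_ofReal hgi.norm
        (Filter.Eventually.of_forall fun x => norm_nonneg _)]
      rw [← h0] at hbig
      refine ENNReal.ofReal_le_ofReal (le_trans ?_ hbig)
      have : 1 * (X * I * Ex) ≤ 6 * Real.exp (1 / ν) * (X * I * Ex) := by
        gcongr; linarith
      linarith
    · refine (sol_grad hν hlam hV hs hL0 hL hi hM hW.diff hgi (a := lam * L + 1) (by positivity)
        ⟨h0, ht.2⟩).trans (ENNReal.ofReal_le_ofReal (le_trans ?_ hbig))
      have h1 : Real.exp (lam / ν * (L / (lam * L + 1) + M)) ≤ Real.exp (1 / ν) * Ex := by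
        rw [hEx, ← Real.exp_add]
        refine Real.exp_le_exp.2 ?_
        have h2 : lam * L / (lam * L + 1) ≤ 1 := by
          rw [div_le_one (by positivity)]; linarith
        have h3 : lam / ν * (L / (lam * L + 1) + M)
          = 1 / ν * (lam * L / (lam * L + 1)) + 1 / ν * (lam * M) := by
          field_simp
        have h4 : 1 / ν * (lam * L / (lam * L + 1)) ≤ 1 / ν * 1 := by gcongr
        have h5 : 1 / ν * (lam * M) ≤ 3 / ν * (lam * M) := by gcongr; norm_num
        rw [h3]; linarith
      have h6 : G + (lam * L + 1) * I ≤ 3 * (X * I) := by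
        have : (lam * L + 1) * I ≤ (X + X) * I := by gcongr
        linarith
      calc 2 * Real.exp (lam / ν * (L / (lam * L + 1) + M)) * (G + (lam * L + 1) * I)
          ≤ 2 * (Real.exp (1 / ν) * Ex) * (3 * (X * I)) := by gcongr
        _ = _ := by ring
  · push Not at ht1
    have ht0 : 0 < t := by linarith
    refine (sol_grad_late hν hlam hV hs hL0 hL hi hM hM0 ⟨ht0, ht.2⟩).trans
      (ENNReal.ofReal_le_ofReal ?_)
    have h1 : 1 / √(t / 2) ≤ 2 * (1 + t) ^ (-(1:ℝ)/2) := by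
      rw [hsq, mul_one_div, div_le_div_iff₀ (by positivity) hsqpos, one_mul]
      have : √(1 + t) ≤ √(2 ^ 2 * (t / 2)) := Real.sqrt_le_sqrt (by linarith)
      rwa [Real.sqrt_mul (by norm_num), Real.sqrt_sq (by norm_num)] at this
    have h2 : I * Ex ≤ X * I * Ex := by
      have : 1 * I ≤ X * I := by gcongr
      gcongr; linarith
    calc A * Ex * I / √(t / 2) = A * (I * Ex) * (1 / √(t / 2)) := by ring
      _ ≤ A * (X * I * Ex) * (2 * (1 + t) ^ (-(1:ℝ)/2)) := by gcongr
      _ = 2 * A * (X * I * Ex * (1 + t) ^ (-(1:ℝ)/2)) := by ring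
      _ ≤ _ := by
        gcongr
        have := Real.exp_pos (1 / ν)
        linarith
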